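/- arXiv:1901.00337 — 18 statements merged into one kernel-verified Lean document; each statement's English description precedes it below -/
import Mathlib

section
/- Let m : (0,1) → ℝ be a Seiffert function, i.e. z/(1+z) ≤ m(z) ≤ z/(1-z) for all z ∈ (0,1). Define M : ℝ₊² → ℝ by M(x,y) = |x-y| / (2·m(|x-y|/(x+y))) for x ≠ y and M(x,x) = x. Then M is a symmetric, homogeneous mean: M(x,y) = M(y,x), M(λx,λy) = λ·M(x,y) for all λ > 0, and min(x,y) ≤ M(x,y) ≤ max(x,y) for all x,y > 0. -/
/-- A Seiffert function `m` gives rise, via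
`M(x,y) = |x-y| / (2 m(|x-y|/(x+y)))` (and `M(x,x) = x`), to a symmetric,
homogeneous mean. -/
theorem seiffert_function_gives_mean
    (m : ℝ → ℝ)
    (hm : ∀ z ∈ Set.Ioo (0 : ℝ) 1, z / (1 + z) ≤ m z ∧ m z ≤ z / (1 - z))
    (M : ℝ → ℝ → ℝ)
    (hMne : ∀ x y : ℝ, 0 < x → 0 < y → x ≠ y →
      M x y = |x - y| / (2 * m (|x - y| / (x + y))))
    (hMeq : ∀ x : ℝ, 0 < x → M x x = x) :
    (∀ x y : ℝ, 0 < x → 0 < y → M x y = M y x) ∧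
    (∀ x y lam : ℝ, 0 < x → 0 < y → 0 < lam →
      M (lam * x) (lam * y) = lam * M x y) ∧
    (∀ x y : ℝ, 0 < x → 0 < y → min x y ≤ M x y ∧ M x y ≤ max x y) := by
  have symm : ∀ x y : ℝ, 0 < x → 0 < y → M x y = M y x := by
    intro x y hx hy
    rcases eq_or_ne x y with rfl | h
    · rfl
    · rw [hMne x y hx hy h, hMne y x hy hx h.symm, abs_sub_comm, add_comm]
  have bounds : ∀ x y : ℝ, 0 < y → y < x → y ≤ M x y ∧ M x y ≤ x := by
    intro x y hy hxy
    have hx : 0 < x := hy.trans hxy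
    have hs : 0 < x + y := add_pos hx hy
    have hd : 0 < x - y := sub_pos.2 hxy
    obtain ⟨hlow, hupp⟩ := hm ((x - y) / (x + y))
      ⟨div_pos hd hs, (div_lt_one hs).2 (by linarith)⟩
    have hplus : (x - y) / (x + y) / (1 + (x - y) / (x + y)) = (x - y) / (2 * x) := by
      rw [show 1 + (x - y) / (x + y) = 2 * x / (x + y) by field_simp; ring,
        div_div_div_cancel_right₀ hs.ne']
    have hminus : (x - y) / (x + y) / (1 - (x - y) / (x + y)) = (x - y) / (2 * y) := by
      rw [show 1 - (x - y) / (x + y) = 2 * y / (x + y) by field_simp; ring,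
        div_div_div_cancel_right₀ hs.ne']
    rw [hplus] at hlow
    rw [hminus] at hupp
    have hpos : 0 < m ((x - y) / (x + y)) := lt_of_lt_of_le (by positivity) hlow
    rw [div_le_iff₀ (by positivity)] at hlow
    rw [le_div_iff₀ (by positivity)] at hupp
    rw [hMne x y hx hy hxy.ne', abs_of_pos hd, le_div_iff₀ (by positivity),
      div_le_iff₀ (by positivity)]
    constructor <;> linarith
  refine ⟨symm, ?_, ?_⟩
  · intro x y lam hx hy hl
    rcases eq_or_ne x y with rfl | h
    · rw [hMeq _ (mul_pos hl hx), hMeq x hx]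
    · rw [hMne _ _ (mul_pos hl hx) (mul_pos hl hy) (mt (mul_left_cancel₀ hl.ne') h),
        hMne x y hx hy h, ← mul_sub, ← mul_add, abs_mul, abs_of_pos hl,
        mul_div_mul_left _ _ hl.ne', mul_div_assoc]
  · intro x y hx hy
    rcases lt_trichotomy x y with h | rfl | h
    · rw [min_eq_left h.le, max_eq_right h.le, symm x y hx hy]
      exact bounds y x hx h
    · simp [hMeq x hx]
    · rw [min_eq_right h.le, max_eq_left h.le]
      exact bounds x y hy h
end

section
/- Let M be a symmetric, homogeneous mean on ℝ₊². Define m : (0,1) → ℝ by m(z) = z / M(1+z, 1-z). Then m is a Seiffert function (i.e. z/(1+z) ≤ m(z) ≤ z/(1-z) on (0,1)), and for all x,y > 0 with x ≠ y one has M(x,y) = |x-y| / (2·m(|x-y|/(x+y))). Moreover m is the unique Seiffert function with this property. -/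
/-- Every symmetric, homogeneous mean `M` has a Seiffert function
`m(z) = z / M(1+z, 1-z)` representing it via
`M(x,y) = |x-y| / (2 m(|x-y|/(x+y)))`, and this Seiffert function is unique. -/
theorem mean_gives_seiffert_function
    (M : ℝ → ℝ → ℝ)
    (hmean : ∀ x y : ℝ, 0 < x → 0 < y → min x y ≤ M x y ∧ M x y ≤ max x y)
    (hsym : ∀ x y : ℝ, 0 < x → 0 < y → M x y = M y x)
    (hhom : ∀ x y lam : ℝ, 0 < x → 0 < y → 0 < lam →
      M (lam * x) (lam * y) = lam * M x y) :
    (∀ z ∈ Set.Ioo (0 : ℝ) 1,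
      z / (1 + z) ≤ z / M (1 + z) (1 - z) ∧ z / M (1 + z) (1 - z) ≤ z / (1 - z)) ∧
    (∀ x y : ℝ, 0 < x → 0 < y → x ≠ y →
      M x y = |x - y| / (2 * ((|x - y| / (x + y)) / M (1 + |x - y| / (x + y)) (1 - |x - y| / (x + y))))) ∧
    (∀ n : ℝ → ℝ,
      (∀ z ∈ Set.Ioo (0 : ℝ) 1, z / (1 + z) ≤ n z ∧ n z ≤ z / (1 - z)) →
      (∀ x y : ℝ, 0 < x → 0 < y → x ≠ y →
        M x y = |x - y| / (2 * n (|x - y| / (x + y)))) →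
      ∀ z ∈ Set.Ioo (0 : ℝ) 1, n z = z / M (1 + z) (1 - z)) := by
  have hpos : ∀ x y : ℝ, 0 < x → 0 < y → 0 < M x y := fun x y hx hy =>
    (lt_min hx hy).trans_le (hmean x y hx hy).1
  have hlt : ∀ x y : ℝ, 0 < x → 0 < y → y < x →
      M x y = |x - y| / (2 * ((|x - y| / (x + y)) /
        M (1 + |x - y| / (x + y)) (1 - |x - y| / (x + y)))) := by
    intro x y hx hy hxy
    have hd : 0 < x - y := sub_pos.mpr hxy
    have hs : 0 < x + y := add_pos hx hy
    have hM := hpos x y hx hy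
    rw [abs_of_pos hd,
      show 1 + (x - y) / (x + y) = 2 / (x + y) * x by field_simp; ring,
      show 1 - (x - y) / (x + y) = 2 / (x + y) * y by field_simp; ring,
      hhom x y _ hx hy (by positivity)]
    have hd' := hd.ne'
    field_simp
  refine ⟨?_, ?_, ?_⟩
  · rintro z ⟨hz0, hz1⟩
    have h1 : 0 < 1 + z := by linarith
    have h2 : 0 < 1 - z := by linarith
    obtain ⟨hl, hu⟩ := hmean _ _ h1 h2
    rw [min_eq_right (by linarith)] at hl
    rw [max_eq_left (by linarith)] at hu
    exact ⟨div_le_div_of_nonneg_left hz0.le (hpos _ _ h1 h2) hu,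
      div_le_div_of_nonneg_left hz0.le h2 hl⟩
  · intro x y hx hy hxy
    rcases hxy.lt_or_gt with h | h
    · rw [hsym x y hx hy, abs_sub_comm, add_comm x y]
      exact hlt y x hy hx h
    · exact hlt x y hx hy h
  · rintro n hn hrep z ⟨hz0, hz1⟩
    have h1 : 0 < 1 + z := by linarith
    have h2 : 0 < 1 - z := by linarith
    have hnz : 0 < n z := (div_pos hz0 h1).trans_le (hn z ⟨hz0, hz1⟩).1
    rw [hrep _ _ h1 h2 (by intro h; linarith),
      show (1 + z) - (1 - z) = 2 * z by ring, show (1 + z) + (1 - z) = 2 by ring,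
      abs_of_pos (by positivity), mul_div_cancel_left₀ z two_ne_zero]
    field_simp
end

section
/- Let M, N be symmetric, homogeneous means with Seiffert functions m, n (so M(x,y) = |x-y|/(2·m(|x-y|/(x+y))) and N(x,y) = |x-y|/(2·n(|x-y|/(x+y))) for x ≠ y). If the function z ↦ n(z)/m(z) is decreasing on (0,1), then for all x,y with 0 < x,y ≤ 1/2 the Ky Fan inequality M(x,y)/M(1-x,1-y) ≤ N(x,y)/N(1-x,1-y) holds. -/
/-- A mean takes the value `x` on the diagonal. -/
theorem mean_self (M : ℝ → ℝ → ℝ)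
    (hM : ∀ x y : ℝ, 0 < x → 0 < y → min x y ≤ M x y ∧ M x y ≤ max x y)
    {x : ℝ} (hx : 0 < x) : M x x = x := by
  have h := hM x x hx hx
  rw [min_self, max_self] at h
  exact le_antisymm h.2 h.1

/-- The argument of a Seiffert function at distinct positive reals lies in `(0,1)`. -/
theorem abs_sub_div_add_mem_Ioo {x y : ℝ} (hx : 0 < x) (hy : 0 < y) (hne : x ≠ y) :
    |x - y| / (x + y) ∈ Set.Ioo (0 : ℝ) 1 := by
  refine ⟨div_pos (abs_pos.mpr (sub_ne_zero.mpr hne)) (by linarith), ?_⟩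
  rw [div_lt_one (by linarith), abs_lt]
  constructor <;> linarith


/-- If `M, N` are symmetric homogeneous means with Seiffert
functions `m, n` and `n/m` is decreasing on `(0,1)`, then the Ky Fan
inequality `M(x,y)/M(1-x,1-y) ≤ N(x,y)/N(1-x,1-y)` holds for `0 < x,y ≤ 1/2`. -/
theorem kyFan_of_ratio_of_seiffert_anti
    (M N : ℝ → ℝ → ℝ) (m n : ℝ → ℝ)
    (hMmean : ∀ x y : ℝ, 0 < x → 0 < y → min x y ≤ M x y ∧ M x y ≤ max x y)
    (hNmean : ∀ x y : ℝ, 0 < x → 0 < y → min x y ≤ N x y ∧ N x y ≤ max x y)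
    (hMsym : ∀ x y : ℝ, 0 < x → 0 < y → M x y = M y x)
    (hNsym : ∀ x y : ℝ, 0 < x → 0 < y → N x y = N y x)
    (hMhom : ∀ x y lam : ℝ, 0 < x → 0 < y → 0 < lam →
      M (lam * x) (lam * y) = lam * M x y)
    (hNhom : ∀ x y lam : ℝ, 0 < x → 0 < y → 0 < lam →
      N (lam * x) (lam * y) = lam * N x y)
    (hmSei : ∀ z ∈ Set.Ioo (0 : ℝ) 1, z / (1 + z) ≤ m z ∧ m z ≤ z / (1 - z))
    (hnSei : ∀ z ∈ Set.Ioo (0 : ℝ) 1, z / (1 + z) ≤ n z ∧ n z ≤ z / (1 - z))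
    (hMrep : ∀ x y : ℝ, 0 < x → 0 < y → x ≠ y →
      M x y = |x - y| / (2 * m (|x - y| / (x + y))))
    (hNrep : ∀ x y : ℝ, 0 < x → 0 < y → x ≠ y →
      N x y = |x - y| / (2 * n (|x - y| / (x + y))))
    (hanti : AntitoneOn (fun z => n z / m z) (Set.Ioo (0 : ℝ) 1)) :
    ∀ x y : ℝ, 0 < x → x ≤ 1 / 2 → 0 < y → y ≤ 1 / 2 →
      M x y / M (1 - x) (1 - y) ≤ N x y / N (1 - x) (1 - y) := by
  intro x y hx hx2 hy hy2
  rcases eq_or_ne x y with rfl | hne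
  · have hMx := mean_self M hMmean hx
    have hNx := mean_self N hNmean hx
    have hMx' := mean_self M hMmean (show 0 < 1 - x by linarith)
    have hNx' := mean_self N hNmean (show 0 < 1 - x by linarith)
    rw [hMx, hNx, hMx', hNx']
  · have hx' : 0 < 1 - x := by linarith
    have hy' : 0 < 1 - y := by linarith
    have hd : 0 < |x - y| := abs_pos.mpr (sub_ne_zero.mpr hne)
    have habs : |1 - x - (1 - y)| = |x - y| := by
      rw [abs_sub_comm x y]
      congr 1
      ring
    have hu := abs_sub_div_add_mem_Ioo hx hy hne
    have hv := abs_sub_div_add_mem_Ioo hx' hy' (by simpa using hne)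
    have hne' : 1 - x ≠ 1 - y := by simpa using hne
    rw [hMrep x y hx hy hne, hNrep x y hx hy hne, hMrep _ _ hx' hy' hne',
      hNrep _ _ hx' hy' hne']
    rw [habs] at hv ⊢
    have hvu : |x - y| / (1 - x + (1 - y)) ≤ |x - y| / (x + y) :=
      div_le_div_of_nonneg_left hd.le (by linarith) (by linarith)
    have hratio := hanti hv hu hvu
    have hpos {f : ℝ → ℝ} (hf : ∀ z ∈ Set.Ioo (0 : ℝ) 1, z / (1 + z) ≤ f z ∧ f z ≤ z / (1 - z))
        {z : ℝ} (hz : z ∈ Set.Ioo (0 : ℝ) 1) : 0 < f z :=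
      (div_pos hz.1 (by linarith [hz.1])).trans_le (hf z hz).1
    have hmu := hpos hmSei hu
    have hmv := hpos hmSei hv
    have hnu := hpos hnSei hu
    have hnv := hpos hnSei hv
    set u := |x - y| / (x + y)
    set v := |x - y| / (1 - x + (1 - y))
    have hcancel {a b : ℝ} (ha : 0 < a) (hb : 0 < b) :
        |x - y| / (2 * a) / (|x - y| / (2 * b)) = b / a := by
      field_simp
    rw [hcancel hmu hmv, hcancel hnu hnv, div_le_div_iff₀ hmu hnu]
    have hcross := (div_le_div_iff₀ hmu hmv).mp hratio
    linarith
end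

section
/- Let M, N be symmetric, homogeneous means on ℝ₊². If the function q(t) = M(1,t)/N(1,t) is increasing on (0,1), then for all x,y with 0 < x,y ≤ 1/2 the Ky Fan inequality M(x,y)/M(1-x,1-y) ≤ N(x,y)/N(1-x,1-y) holds. -/
/-- If `M, N` are symmetric homogeneous means and
`q(t) = M(1,t)/N(1,t)` is increasing on `(0,1)`, then the Ky Fan inequality
`M(x,y)/M(1-x,1-y) ≤ N(x,y)/N(1-x,1-y)` holds for `0 < x,y ≤ 1/2`. -/
theorem kyFan_of_ratio_monotone
    (M N : ℝ → ℝ → ℝ)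
    (hMmean : ∀ x y : ℝ, 0 < x → 0 < y → min x y ≤ M x y ∧ M x y ≤ max x y)
    (hNmean : ∀ x y : ℝ, 0 < x → 0 < y → min x y ≤ N x y ∧ N x y ≤ max x y)
    (hMsym : ∀ x y : ℝ, 0 < x → 0 < y → M x y = M y x)
    (hNsym : ∀ x y : ℝ, 0 < x → 0 < y → N x y = N y x)
    (hMhom : ∀ x y lam : ℝ, 0 < x → 0 < y → 0 < lam →
      M (lam * x) (lam * y) = lam * M x y)
    (hNhom : ∀ x y lam : ℝ, 0 < x → 0 < y → 0 < lam →
      N (lam * x) (lam * y) = lam * N x y)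
    (hmono : MonotoneOn (fun t => M 1 t / N 1 t) (Set.Ioo (0 : ℝ) 1)) :
    ∀ x y : ℝ, 0 < x → x ≤ 1 / 2 → 0 < y → y ≤ 1 / 2 →
      M x y / M (1 - x) (1 - y) ≤ N x y / N (1 - x) (1 - y) := by
  have pos_of_mean : ∀ F : ℝ → ℝ → ℝ,
      (∀ x y : ℝ, 0 < x → 0 < y → min x y ≤ F x y ∧ F x y ≤ max x y) →
      ∀ x y : ℝ, 0 < x → 0 < y → 0 < F x y :=
    fun F hF x y hx hy => (lt_min hx hy).trans_le (hF x y hx hy).1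
  have diag_of_mean : ∀ F : ℝ → ℝ → ℝ,
      (∀ x y : ℝ, 0 < x → 0 < y → min x y ≤ F x y ∧ F x y ≤ max x y) →
      ∀ x : ℝ, 0 < x → F x x = x := by
    intro F hF x hx
    obtain ⟨h₁, h₂⟩ := hF x x hx hx
    rw [min_self] at h₁
    rw [max_self] at h₂
    exact le_antisymm h₂ h₁
  have hMpos := pos_of_mean M hMmean
  have hNpos := pos_of_mean N hNmean
  have ratio_eq : ∀ a b : ℝ, 0 < a → 0 < b → M a b / N a b = M 1 (b / a) / N 1 (b / a) := by
    intro a b ha hb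
    have hM := hMhom 1 (b / a) a one_pos (div_pos hb ha) ha
    have hN := hNhom 1 (b / a) a one_pos (div_pos hb ha) ha
    rw [mul_one, mul_div_cancel₀ b ha.ne'] at hM hN
    rw [hM, hN, mul_div_mul_left _ _ ha.ne']
  have kyFan_of_lt : ∀ x y : ℝ, 0 < y → y < x → x ≤ 1 / 2 →
      M x y / M (1 - x) (1 - y) ≤ N x y / N (1 - x) (1 - y) := by
    intro x y hy hyx hx
    have hx₀ : 0 < x := hy.trans hyx
    have hx₁ : 0 < 1 - x := by linarith
    have hy₁ : 0 < 1 - y := by linarith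
    have hle : y / x ≤ (1 - x) / (1 - y) := by
      rw [div_le_div_iff₀ hx₀ hy₁]
      nlinarith
    have hq := hmono ⟨div_pos hy hx₀, (div_lt_one hx₀).2 hyx⟩
      ⟨div_pos hx₁ hy₁, (div_lt_one hy₁).2 (by linarith)⟩ hle
    simp only [← ratio_eq x y hx₀ hy, ← ratio_eq (1 - y) (1 - x) hy₁ hx₁,
      hMsym (1 - y) (1 - x) hy₁ hx₁, hNsym (1 - y) (1 - x) hy₁ hx₁] at hq
    rw [div_le_div_iff₀ (hNpos _ _ hx₀ hy) (hNpos _ _ hx₁ hy₁)] at hq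
    rw [div_le_div_iff₀ (hMpos _ _ hx₁ hy₁) (hNpos _ _ hx₁ hy₁)]
    linarith
  intro x y hx₀ hx hy₀ hy
  have hx₁ : 0 < 1 - x := by linarith
  have hy₁ : 0 < 1 - y := by linarith
  rcases lt_trichotomy x y with h | rfl | h
  · rw [hMsym x y hx₀ hy₀, hNsym x y hx₀ hy₀, hMsym _ _ hx₁ hy₁, hNsym _ _ hx₁ hy₁]
    exact kyFan_of_lt y x hx₀ h hy
  · rw [diag_of_mean M hMmean x hx₀, diag_of_mean N hNmean x hx₀,
      diag_of_mean M hMmean _ hx₁, diag_of_mean N hNmean _ hx₁]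
  · exact kyFan_of_lt x y hy₀ h hx
end

section
/- Let M, N be symmetric, homogeneous means with Seiffert functions m, n (so M(x,y) = |x-y|/(2·m(|x-y|/(x+y))) and N(x,y) = |x-y|/(2·n(|x-y|/(x+y))) for x ≠ y). If the function z ↦ m(z) - n(z) is decreasing on (0,1), then for all x,y with 0 < x,y ≤ 1/2 the harmonic Ky Fan inequality 1/M(x,y) - 1/M(1-x,1-y) ≤ 1/N(x,y) - 1/N(1-x,1-y) holds. -/
/-- If `M, N` are symmetric homogeneous means with Seiffert
functions `m, n` and `m - n` is decreasing on `(0,1)`, then the harmonic Ky Fan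
inequality `1/M(x,y) - 1/M(1-x,1-y) ≤ 1/N(x,y) - 1/N(1-x,1-y)` holds for
`0 < x,y ≤ 1/2`. -/
theorem harmonicKyFan_of_diff_of_seiffert_anti
    (M N : ℝ → ℝ → ℝ) (m n : ℝ → ℝ)
    (hMmean : ∀ x y : ℝ, 0 < x → 0 < y → min x y ≤ M x y ∧ M x y ≤ max x y)
    (hNmean : ∀ x y : ℝ, 0 < x → 0 < y → min x y ≤ N x y ∧ N x y ≤ max x y)
    (hMsym : ∀ x y : ℝ, 0 < x → 0 < y → M x y = M y x)
    (hNsym : ∀ x y : ℝ, 0 < x → 0 < y → N x y = N y x)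
    (hMhom : ∀ x y lam : ℝ, 0 < x → 0 < y → 0 < lam →
      M (lam * x) (lam * y) = lam * M x y)
    (hNhom : ∀ x y lam : ℝ, 0 < x → 0 < y → 0 < lam →
      N (lam * x) (lam * y) = lam * N x y)
    (hmSei : ∀ z ∈ Set.Ioo (0 : ℝ) 1, z / (1 + z) ≤ m z ∧ m z ≤ z / (1 - z))
    (hnSei : ∀ z ∈ Set.Ioo (0 : ℝ) 1, z / (1 + z) ≤ n z ∧ n z ≤ z / (1 - z))
    (hMrep : ∀ x y : ℝ, 0 < x → 0 < y → x ≠ y →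
      M x y = |x - y| / (2 * m (|x - y| / (x + y))))
    (hNrep : ∀ x y : ℝ, 0 < x → 0 < y → x ≠ y →
      N x y = |x - y| / (2 * n (|x - y| / (x + y))))
    (hanti : AntitoneOn (fun z => m z - n z) (Set.Ioo (0 : ℝ) 1)) :
    ∀ x y : ℝ, 0 < x → x ≤ 1 / 2 → 0 < y → y ≤ 1 / 2 →
      1 / M x y - 1 / M (1 - x) (1 - y) ≤ 1 / N x y - 1 / N (1 - x) (1 - y) := by
  intro x y hx hx' hy hy'
  have hx1 : 0 < 1 - x := by linarith
  have hy1 : 0 < 1 - y := by linarith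
  rcases eq_or_ne x y with rfl | hne
  · have mean_self {K : ℝ → ℝ → ℝ}
        (hK : ∀ x y : ℝ, 0 < x → 0 < y → min x y ≤ K x y ∧ K x y ≤ max x y)
        {t : ℝ} (ht : 0 < t) : K t t = t :=
      le_antisymm (by simpa using (hK t t ht ht).2) (by simpa using (hK t t ht ht).1)
    rw [mean_self hMmean hx, mean_self hMmean hx1, mean_self hNmean hx, mean_self hNmean hx1]
  · have hne' : 1 - x ≠ 1 - y := fun h => hne (by linarith)
    have habs : |(1 - x) - (1 - y)| = |x - y| := by
      rw [sub_sub_sub_cancel_left, abs_sub_comm]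
    have hd : 0 < |x - y| := abs_pos.mpr (sub_ne_zero.mpr hne)
    have mem_Ioo {s : ℝ} (hs : |x - y| < s) : |x - y| / s ∈ Set.Ioo (0 : ℝ) 1 :=
      ⟨div_pos hd (hd.trans hs), (div_lt_one (hd.trans hs)).mpr hs⟩
    have hlt : |x - y| < x + y := abs_lt.mpr ⟨by linarith, by linarith⟩
    have hlt' : |x - y| < (1 - x) + (1 - y) := by linarith
    have hle : |x - y| / ((1 - x) + (1 - y)) ≤ |x - y| / (x + y) :=
      div_le_div_of_nonneg_left hd.le (by linarith) (by linarith)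
    have key := hanti (mem_Ioo hlt') (mem_Ioo hlt) hle
    rw [hMrep x y hx hy hne, hNrep x y hx hy hne, hMrep _ _ hx1 hy1 hne',
      hNrep _ _ hx1 hy1 hne', habs]
    simp only [one_div_div, ← sub_div]
    exact div_le_div_of_nonneg_right (by linarith) hd.le
end

section
/- Let M, N be symmetric, homogeneous means on ℝ₊². If the function g(s) = (s-1)·(1/M(s,1) - 1/N(s,1)) is decreasing for s > 1, then for all x,y with 0 < x,y ≤ 1/2 the inequality 1/M(x,y) - 1/M(1-x,1-y) ≤ 1/N(x,y) - 1/N(1-x,1-y) holds. -/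
/-- A homogeneous function of two variables is determined by its values at `(s, 1)`; this rescales
the reciprocal of such a function. -/
theorem sub_mul_one_div_of_homogeneous {M : ℝ → ℝ → ℝ}
    (hM : ∀ x y lam : ℝ, 0 < x → 0 < y → 0 < lam → M (lam * x) (lam * y) = lam * M x y)
    {x y : ℝ} (hx : 0 < x) (hy : 0 < y) :
    (x - y) * (1 / M x y) = (x / y - 1) * (1 / M (x / y) 1) := by
  have h := hM (x / y) 1 y (div_pos hx hy) one_pos hy
  rw [mul_div_cancel₀ x hy.ne', mul_one] at h
  rw [h, one_div, mul_inv, one_div]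
  field_simp

/-- If `M, N` are symmetric homogeneous means and
`g(s) = (s-1)(1/M(s,1) - 1/N(s,1))` is decreasing for `s > 1`, then the
harmonic Ky Fan inequality `1/M(x,y) - 1/M(1-x,1-y) ≤ 1/N(x,y) - 1/N(1-x,1-y)`
holds for `0 < x,y ≤ 1/2`. -/
theorem harmonicKyFan_of_g_anti
    (M N : ℝ → ℝ → ℝ)
    (hMmean : ∀ x y : ℝ, 0 < x → 0 < y → min x y ≤ M x y ∧ M x y ≤ max x y)
    (hNmean : ∀ x y : ℝ, 0 < x → 0 < y → min x y ≤ N x y ∧ N x y ≤ max x y)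
    (hMsym : ∀ x y : ℝ, 0 < x → 0 < y → M x y = M y x)
    (hNsym : ∀ x y : ℝ, 0 < x → 0 < y → N x y = N y x)
    (hMhom : ∀ x y lam : ℝ, 0 < x → 0 < y → 0 < lam →
      M (lam * x) (lam * y) = lam * M x y)
    (hNhom : ∀ x y lam : ℝ, 0 < x → 0 < y → 0 < lam →
      N (lam * x) (lam * y) = lam * N x y)
    (hanti : AntitoneOn (fun s => (s - 1) * (1 / M s 1 - 1 / N s 1)) (Set.Ioi (1 : ℝ))) :
    ∀ x y : ℝ, 0 < x → x ≤ 1 / 2 → 0 < y → y ≤ 1 / 2 →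
      1 / M x y - 1 / M (1 - x) (1 - y) ≤ 1 / N x y - 1 / N (1 - x) (1 - y) := by
  have key : ∀ x y : ℝ, 0 < y → y < x → x ≤ 1 / 2 →
      1 / M x y - 1 / M (1 - x) (1 - y) ≤ 1 / N x y - 1 / N (1 - x) (1 - y) := by
    intro x y hy hyx hx
    have hx0 : 0 < x := hy.trans hyx
    have hx1 : 0 < 1 - x := by linarith
    have hy1 : 0 < 1 - y := by linarith
    have hs : 1 < (1 - y) / (1 - x) := (one_lt_div hx1).2 (by linarith)
    have hle : (1 - y) / (1 - x) ≤ x / y := by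
      rw [div_le_div_iff₀ hx1 hy]
      nlinarith
    have h := hanti (Set.mem_Ioi.2 hs) (Set.mem_Ioi.2 (hs.trans_le hle)) hle
    simp only [mul_sub] at h
    rw [← sub_mul_one_div_of_homogeneous hMhom hx0 hy,
      ← sub_mul_one_div_of_homogeneous hNhom hx0 hy,
      ← sub_mul_one_div_of_homogeneous hMhom hy1 hx1,
      ← sub_mul_one_div_of_homogeneous hNhom hy1 hx1,
      hMsym _ _ hy1 hx1, hNsym _ _ hy1 hx1] at h
    refine le_of_mul_le_mul_left ?_ (sub_pos.2 hyx)
    linear_combination h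
  intro x y hx hx2 hy hy2
  have hx1 : 0 < 1 - x := by linarith
  have hy1 : 0 < 1 - y := by linarith
  rcases lt_trichotomy x y with hxy | rfl | hxy
  · rw [hMsym x y hx hy, hNsym x y hx hy, hMsym _ _ hx1 hy1, hNsym _ _ hx1 hy1]
    exact key y x hx hxy hy2
  · have diag : ∀ z : ℝ, 0 < z → M z z = N z z := by
      intro z hz
      have hM := hMmean z z hz hz
      have hN := hNmean z z hz hz
      rw [min_self, max_self] at hM hN
      linarith
    rw [diag x hx, diag _ hx1]
  · exact key x y hy hxy hx2
end

section
/- Let A_r denote the power mean of order r: A_r(x,y) = ((x^r + y^r)/2)^{1/r} for r ≠ 0 and A_0(x,y) = √(xy). If r < s, then for all x,y with 0 < x,y ≤ 1/2 one has A_r(x,y)/A_r(1-x,1-y) ≤ A_s(x,y)/A_s(1-x,1-y). -/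
/-- The power mean of order `r` of two positive reals. -/
noncomputable def powerMean (r x y : ℝ) : ℝ :=
  if r = 0 then Real.sqrt (x * y) else ((x ^ r + y ^ r) / 2) ^ (1 / r)

theorem Real.monotone_tanh : Monotone Real.tanh := by
  intro a b hab
  rw [Real.tanh_eq_sinh_div_cosh, Real.tanh_eq_sinh_div_cosh,
    div_le_div_iff₀ (Real.cosh_pos a) (Real.cosh_pos b)]
  have h : 0 ≤ Real.sinh (b - a) := Real.sinh_nonneg_iff.mpr (sub_nonneg.mpr hab)
  rw [Real.sinh_sub] at h
  linarith

/-- The logarithm of the power mean of order `r` of `exp u` and `exp (-u)`. -/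
noncomputable def logPowerMeanExp (r u : ℝ) : ℝ :=
  if r = 0 then 0 else Real.log (Real.cosh (r * u)) / r

theorem powerMean_comm (r x y : ℝ) : powerMean r x y = powerMean r y x := by
  simp only [powerMean, mul_comm x, add_comm (x ^ r)]

theorem powerMean_exp (r a u : ℝ) :
    powerMean r (Real.exp (a + u)) (Real.exp (a - u)) =
      Real.exp (a + logPowerMeanExp r u) := by
  unfold powerMean logPowerMeanExp
  split_ifs with hr
  · rw [← Real.exp_add, show a + u + (a - u) = a + a by ring, Real.exp_add,
      Real.sqrt_mul_self (Real.exp_pos a).le, add_zero]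
  · have h : (Real.exp (a + u) ^ r + Real.exp (a - u) ^ r) / 2 =
        Real.exp (a * r + Real.log (Real.cosh (r * u))) := by
      rw [← Real.exp_mul, ← Real.exp_mul, Real.exp_add, Real.exp_log (Real.cosh_pos _),
        Real.cosh_eq, show (a + u) * r = a * r + r * u by ring,
        show (a - u) * r = a * r + -(r * u) by ring, Real.exp_add, Real.exp_add]
      ring
    rw [h, ← Real.exp_mul]
    congr 1
    field_simp

theorem powerMean_eq_exp (r : ℝ) {x y : ℝ} (hx : 0 < x) (hy : 0 < y) :
    powerMean r x y = Real.exp ((Real.log x + Real.log y) / 2 +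
      logPowerMeanExp r ((Real.log x - Real.log y) / 2)) := by
  rw [← powerMean_exp]
  congr 1
  · rw [show (Real.log x + Real.log y) / 2 + (Real.log x - Real.log y) / 2 = Real.log x by ring,
      Real.exp_log hx]
  · rw [show (Real.log x + Real.log y) / 2 - (Real.log x - Real.log y) / 2 = Real.log y by ring,
      Real.exp_log hy]

theorem hasDerivAt_logPowerMeanExp (r u : ℝ) :
    HasDerivAt (logPowerMeanExp r) (Real.tanh (r * u)) u := by
  by_cases hr : r = 0
  · subst hr
    have h : logPowerMeanExp 0 = fun _ => 0 := by
      funext t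
      simp [logPowerMeanExp]
    rw [h]
    simpa using hasDerivAt_const u (0 : ℝ)
  · have h : logPowerMeanExp r = fun t => Real.log (Real.cosh (r * t)) / r := by
      funext t
      simp [logPowerMeanExp, hr]
    rw [h]
    have hd := ((((hasDerivAt_id u).const_mul r).cosh).log
      (Real.cosh_pos (r * u)).ne').div_const r
    refine hd.congr_deriv ?_
    rw [Real.tanh_eq_sinh_div_cosh]
    simp only [id]
    field_simp

theorem logPowerMeanExp_neg (r u : ℝ) : logPowerMeanExp r (-u) = logPowerMeanExp r u := by
  simp [logPowerMeanExp]

theorem monotoneOn_logPowerMeanExp_sub {r s : ℝ} (hrs : r ≤ s) :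
    MonotoneOn (fun u => logPowerMeanExp s u - logPowerMeanExp r u) (Set.Ici 0) := by
  have hd : ∀ u, HasDerivAt (fun u => logPowerMeanExp s u - logPowerMeanExp r u)
      (Real.tanh (s * u) - Real.tanh (r * u)) u := fun u =>
    (hasDerivAt_logPowerMeanExp s u).sub (hasDerivAt_logPowerMeanExp r u)
  refine monotoneOn_of_deriv_nonneg (convex_Ici 0)
    (fun u _ => (hd u).continuousAt.continuousWithinAt)
    (fun u _ => (hd u).differentiableAt.differentiableWithinAt) fun u hu => ?_
  rw [interior_Ici, Set.mem_Ioi] at hu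
  rw [(hd u).deriv, sub_nonneg]
  exact Real.monotone_tanh (mul_le_mul_of_nonneg_right hrs hu.le)

/-- Ky Fan inequality for power means (Chan–Goldberg–Gonek):
if `r < s`, then `A_r(x,y)/A_r(1-x,1-y) ≤ A_s(x,y)/A_s(1-x,1-y)` for
`0 < x, y ≤ 1/2`. -/
theorem kyFan_powerMean {r s : ℝ} (hrs : r < s) :
    ∀ x y : ℝ, 0 < x → x ≤ 1 / 2 → 0 < y → y ≤ 1 / 2 →
      powerMean r x y / powerMean r (1 - x) (1 - y) ≤
        powerMean s x y / powerMean s (1 - x) (1 - y) := by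
  intro x y hx hx2 hy hy2
  wlog hyx : y ≤ x generalizing x y
  · have h := this y x hy hy2 hx hx2 (not_le.mp hyx).le
    simpa only [powerMean_comm _ y x, powerMean_comm _ (1 - y) (1 - x)] using h
  have hx1 : 0 < 1 - x := by linarith
  have hy1 : 0 < 1 - y := by linarith
  have hlog : Real.log (1 - x) ≤ Real.log (1 - y) := Real.log_le_log hx1 (by linarith)
  have hprod : Real.log y + Real.log (1 - y) ≤ Real.log x + Real.log (1 - x) := by
    rw [← Real.log_mul hy.ne' hy1.ne', ← Real.log_mul hx.ne' hx1.ne']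
    exact Real.log_le_log (mul_pos hy hy1) (by nlinarith)
  have hmono := monotoneOn_logPowerMeanExp_sub hrs.le
    (a := (Real.log (1 - y) - Real.log (1 - x)) / 2) (b := (Real.log x - Real.log y) / 2)
    (Set.mem_Ici.mpr (by linarith)) (Set.mem_Ici.mpr (by linarith)) (by linarith)
  have hneg : (Real.log (1 - x) - Real.log (1 - y)) / 2 =
      -((Real.log (1 - y) - Real.log (1 - x)) / 2) := by ring
  simp only [powerMean_eq_exp _ hx hy, powerMean_eq_exp _ hx1 hy1, ← Real.exp_sub, hneg,
    logPowerMeanExp_neg]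
  exact Real.exp_le_exp.mpr (by linarith)
end

section
/- Let T(x,y) = |x-y|/(2·arctan(|x-y|/(x+y))) for x ≠ y, T(x,x) = x, be the second Seiffert mean, and let Q(x,y) = √((x² + y²)/2) be the quadratic mean. Then for all x,y with 0 < x,y ≤ 1/2 and x ≠ y, T(x,y)/T(1-x,1-y) < Q(x,y)/Q(1-x,1-y). -/
/-- The second Seiffert mean. -/
noncomputable def seiffertT (x y : ℝ) : ℝ :=
  if x = y then x else |x - y| / (2 * Real.arctan (|x - y| / (x + y)))

/-- The quadratic mean (root mean square). -/
noncomputable def quadraticMean (x y : ℝ) : ℝ :=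
  Real.sqrt ((x ^ 2 + y ^ 2) / 2)

/-- `sin a / a` is strictly decreasing on `(0, π]`, in cross-multiplied form. -/
theorem Real.mul_sin_lt_mul_sin {a b : ℝ} (hb : 0 < b) (hba : b < a) (ha : a ≤ Real.pi) :
    b * Real.sin a < a * Real.sin b := by
  have ha0 : 0 < a := hb.trans hba
  have h := strictConcaveOn_sin_Icc.2 (x := 0) (y := a) ⟨le_rfl, Real.pi_pos.le⟩ ⟨ha0.le, ha⟩
    ha0.ne (sub_pos.2 ((div_lt_one ha0).2 hba)) (div_pos hb ha0) (sub_add_cancel 1 (b / a))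
  simp only [smul_eq_mul, Real.sin_zero, mul_zero, zero_add, div_mul_cancel₀ b ha0.ne'] at h
  rwa [div_mul_eq_mul_div, div_lt_iff₀ ha0, mul_comm (Real.sin b)] at h

/-- The quadratic mean in terms of the angle that defines the second Seiffert mean. -/
theorem quadraticMean_eq_div_sin_arctan {x y : ℝ} (hx : 0 < x) (hy : 0 < y) (hxy : x ≠ y) :
    quadraticMean x y = |x - y| / (2 * Real.sin (Real.arctan (|x - y| / (x + y)))) := by
  have hd : 0 < |x - y| := abs_pos.2 (sub_ne_zero.2 hxy)
  have hs : 0 < x + y := add_pos hx hy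
  have hq : 0 < (x ^ 2 + y ^ 2) / 2 := by positivity
  have hQ : 0 < quadraticMean x y := Real.sqrt_pos.2 hq
  have key : Real.sqrt (1 + (|x - y| / (x + y)) ^ 2) = 2 * quadraticMean x y / (x + y) := by
    rw [Real.sqrt_eq_iff_mul_self_eq (by positivity) (by positivity), ← sq, div_pow, div_pow,
      mul_pow, quadraticMean, Real.sq_sqrt hq.le, sq_abs]
    field_simp
    ring
  rw [Real.sin_arctan, key]
  field_simp

/-- `T(x,y)/T(1-x,1-y) < Q(x,y)/Q(1-x,1-y)` for `0 < x,y ≤ 1/2`,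
`x ≠ y`. -/
theorem kyFan_seiffertT_lt_quadratic :
    ∀ x y : ℝ, 0 < x → x ≤ 1 / 2 → 0 < y → y ≤ 1 / 2 → x ≠ y →
      seiffertT x y / seiffertT (1 - x) (1 - y) <
        quadraticMean x y / quadraticMean (1 - x) (1 - y) := by
  intro x y hx hx2 hy hy2 hxy
  have hxy' : 1 - x ≠ 1 - y := fun h => hxy (sub_right_injective h)
  have hd : 0 < |x - y| := abs_pos.2 (sub_ne_zero.2 hxy)
  have habs : |1 - x - (1 - y)| = |x - y| := by
    rw [sub_sub_sub_cancel_left, abs_sub_comm]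
  have hs : x + y < 1 - x + (1 - y) := by
    rcases hxy.lt_or_gt with h | h <;> linarith
  rw [quadraticMean_eq_div_sin_arctan hx hy hxy,
    quadraticMean_eq_div_sin_arctan (by linarith) (by linarith) hxy', seiffertT, seiffertT,
    if_neg hxy, if_neg hxy', habs]
  have hs0 : 0 < x + y := add_pos hx hy
  set b := Real.arctan (|x - y| / (1 - x + (1 - y)))
  set a := Real.arctan (|x - y| / (x + y))
  have hb : 0 < b := Real.arctan_pos.2 (div_pos hd (hs0.trans hs))
  have hba : b < a := Real.arctan_strictMono (div_lt_div_of_pos_left hd hs0 hs)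
  have ha : a < Real.pi := (Real.arctan_lt_pi_div_two _).trans (by linarith [Real.pi_pos])
  have hsa : 0 < Real.sin a := Real.sin_pos_of_pos_of_lt_pi (hb.trans hba) ha
  have hcancel (u v : ℝ) : |x - y| / (2 * u) / (|x - y| / (2 * v)) = v / u := by
    rw [div_div_div_cancel_left' _ _ hd.ne', mul_div_mul_left _ _ two_ne_zero]
  rw [hcancel, hcancel, div_lt_div_iff₀ (hb.trans hba) hsa, mul_comm (Real.sin b)]
  exact Real.mul_sin_lt_mul_sin hb hba ha.le
end

section
/- Let He(x,y) = (x + √(xy) + y)/3 be the Heronian mean and A_{1/2}(x,y) = ((√x + √y)/2)² the power mean of order 1/2. Then for all x,y with 0 < x,y ≤ 1/2 and x ≠ y, A_{1/2}(x,y)/A_{1/2}(1-x,1-y) < He(x,y)/He(1-x,1-y). -/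
/-- The Heronian mean. -/
noncomputable def heronianMean (x y : ℝ) : ℝ :=
  (x + Real.sqrt (x * y) + y) / 3

/-- The power mean of order `1/2`. -/
noncomputable def powerMeanHalf (x y : ℝ) : ℝ :=
  ((Real.sqrt x + Real.sqrt y) / 2) ^ 2

/-- The ratio of the geometric mean to the arithmetic mean of `a, b` is smaller than that of `c, d`
when `c / d` lies strictly between `b / a` and `a / b`. -/
theorem mul_mul_add_sq_lt_of_mul_lt_mul {a b c d : ℝ} (h₁ : b * c < a * d) (h₂ : b * d < a * c) :
    a * b * (c + d) ^ 2 < c * d * (a + b) ^ 2 := by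
  nlinarith [mul_pos (sub_pos.2 h₁) (sub_pos.2 h₂)]

theorem sqrt_mul_sqrt_mul_add_sq_lt {x y : ℝ} (hy : 0 < y) (hyx : y < x) (hx : x ≤ 1 / 2) :
    √x * √y * (√(1 - x) + √(1 - y)) ^ 2 < √(1 - x) * √(1 - y) * (√x + √y) ^ 2 := by
  apply mul_mul_add_sq_lt_of_mul_lt_mul
  · rw [← Real.sqrt_mul hy.le, ← Real.sqrt_mul (hy.trans hyx).le]
    exact Real.sqrt_lt_sqrt (by nlinarith) (by nlinarith)
  · rw [← Real.sqrt_mul hy.le, ← Real.sqrt_mul (hy.trans hyx).le]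
    exact Real.sqrt_lt_sqrt (by nlinarith) (by nlinarith)

theorem heronianMean_eq_sqrt {x y : ℝ} (hx : 0 ≤ x) (hy : 0 ≤ y) :
    heronianMean x y = ((√x + √y) ^ 2 - √x * √y) / 3 := by
  rw [heronianMean, Real.sqrt_mul hx]
  linear_combination (-1 / 3) * Real.sq_sqrt hx + (-1 / 3) * Real.sq_sqrt hy

/-- `A_{1/2}(x,y)/A_{1/2}(1-x,1-y) < He(x,y)/He(1-x,1-y)` for
`0 < x,y ≤ 1/2`, `x ≠ y`. -/
theorem kyFan_powerMeanHalf_lt_heronian :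
    ∀ x y : ℝ, 0 < x → x ≤ 1 / 2 → 0 < y → y ≤ 1 / 2 → x ≠ y →
      powerMeanHalf x y / powerMeanHalf (1 - x) (1 - y) <
        heronianMean x y / heronianMean (1 - x) (1 - y) := by
  intro x y hx hx' hy hy' hxy
  have key : √x * √y * (√(1 - x) + √(1 - y)) ^ 2 < √(1 - x) * √(1 - y) * (√x + √y) ^ 2 := by
    rcases lt_or_gt_of_ne hxy with h | h
    · linarith [sqrt_mul_sqrt_mul_add_sq_lt hx h hy']
    · exact sqrt_mul_sqrt_mul_add_sq_lt hy h hx'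
  have hc : 0 < √(1 - x) := Real.sqrt_pos.2 (by linarith)
  have hd : 0 < √(1 - y) := Real.sqrt_pos.2 (by linarith)
  rw [heronianMean_eq_sqrt hx.le hy.le, heronianMean_eq_sqrt (by linarith) (by linarith),
    powerMeanHalf, powerMeanHalf, div_lt_div_iff₀ (by positivity)
      (by nlinarith [mul_pos hc hd])]
  linarith
end

section
/- Let He(x,y) = (x + √(xy) + y)/3 be the Heronian mean and A_{2/3}(x,y) = ((x^{2/3} + y^{2/3})/2)^{3/2} the power mean of order 2/3. Then for all x,y with 0 < x,y ≤ 1/2 and x ≠ y, He(x,y)/He(1-x,1-y) < A_{2/3}(x,y)/A_{2/3}(1-x,1-y). -/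
/-- The power mean of order `2/3`. -/
noncomputable def powerMeanTwoThirds (x y : ℝ) : ℝ :=
  ((x ^ ((2 : ℝ) / 3) + y ^ ((2 : ℝ) / 3)) / 2) ^ ((3 : ℝ) / 2)

open Real Set

/-- The squared quotient of the Heronian mean by the power mean of order `2/3` of `s ^ 6` and `1`,
up to a constant factor. -/
noncomputable def meanRatio (s : ℝ) : ℝ :=
  (1 + s ^ 3 + s ^ 6) ^ 2 / (1 + s ^ 4) ^ 3

lemma hasDerivAt_meanRatio (s : ℝ) :
    HasDerivAt meanRatio
      (6 * s ^ 2 * (1 + s ^ 3 + s ^ 6) * ((1 - s ^ 2) * (1 - s) ^ 2) / (1 + s ^ 4) ^ 4) s := by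
  have hN : HasDerivAt (fun s : ℝ => 1 + s ^ 3 + s ^ 6) (3 * s ^ 2 + 6 * s ^ 5) s := by
    simpa using ((hasDerivAt_pow 3 s).const_add 1).fun_add (hasDerivAt_pow 6 s)
  have hD : HasDerivAt (fun s : ℝ => 1 + s ^ 4) (4 * s ^ 3) s := by
    simpa using (hasDerivAt_pow 4 s).const_add 1
  have hpos : (1 + s ^ 4 : ℝ) ≠ 0 := by positivity
  refine ((hN.fun_pow 2).fun_div (hD.fun_pow 3) (pow_ne_zero 3 hpos)).congr_deriv ?_
  field_simp
  push_cast
  ring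

lemma strictAntiOn_meanRatio : StrictAntiOn meanRatio (Ici 1) := by
  refine strictAntiOn_of_deriv_neg (convex_Ici 1)
    (fun s _ => (hasDerivAt_meanRatio s).continuousAt.continuousWithinAt) fun s hs => ?_
  rw [interior_Ici, mem_Ioi] at hs
  rw [(hasDerivAt_meanRatio s).deriv]
  have hs0 : 0 < s := by linarith
  have hsq : 0 < (s - 1) ^ 2 := pow_pos (by linarith) 2
  have hneg : (1 - s ^ 2) * (1 - s) ^ 2 < 0 :=
    mul_neg_of_neg_of_pos (by nlinarith) (by linarith [sub_sq_comm s 1])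
  exact div_neg_of_neg_of_pos (mul_neg_of_pos_of_neg (by positivity) hneg) (by positivity)

lemma heronianMean_pos {x y : ℝ} (hx : 0 < x) (hy : 0 < y) : 0 < heronianMean x y := by
  unfold heronianMean
  positivity

lemma powerMeanTwoThirds_pos {x y : ℝ} (hx : 0 < x) (hy : 0 < y) :
    0 < powerMeanTwoThirds x y := by
  unfold powerMeanTwoThirds
  positivity

lemma heronianMean_comm (x y : ℝ) : heronianMean x y = heronianMean y x := by
  simp only [heronianMean, mul_comm y x]
  ring

lemma powerMeanTwoThirds_comm (x y : ℝ) : powerMeanTwoThirds x y = powerMeanTwoThirds y x := by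
  simp only [powerMeanTwoThirds, add_comm]

lemma heronianMean_pow_six {a b : ℝ} (ha : 0 ≤ a) (hb : 0 ≤ b) :
    heronianMean (a ^ 6) (b ^ 6) = (a ^ 6 + a ^ 3 * b ^ 3 + b ^ 6) / 3 := by
  have h : a ^ 6 * b ^ 6 = (a ^ 3 * b ^ 3) ^ 2 := by ring
  rw [heronianMean, h, sqrt_sq (by positivity)]

lemma powerMeanTwoThirds_pow_six_sq {a b : ℝ} (ha : 0 ≤ a) (hb : 0 ≤ b) :
    powerMeanTwoThirds (a ^ 6) (b ^ 6) ^ 2 = ((a ^ 4 + b ^ 4) / 2) ^ 3 := by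
  have h {c : ℝ} (hc : 0 ≤ c) : (c ^ 6) ^ ((2 : ℝ) / 3) = c ^ 4 := by
    rw [← rpow_natCast_mul hc, ← rpow_natCast]
    norm_num
  rw [powerMeanTwoThirds, h ha, h hb, ← rpow_mul_natCast (by positivity), ← rpow_natCast]
  norm_num

lemma heronianMean_div_powerMeanTwoThirds_sq {x y : ℝ} (hx : 0 < x) (hy : 0 < y) :
    (heronianMean x y / powerMeanTwoThirds x y) ^ 2 =
      8 / 9 * meanRatio ((x / y) ^ ((6 : ℝ)⁻¹)) := by
  obtain ⟨a, ha, rfl⟩ : ∃ a : ℝ, 0 < a ∧ a ^ 6 = x :=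
    ⟨x ^ ((6 : ℝ)⁻¹), by positivity, by
      simpa using rpow_inv_natCast_pow hx.le (n := 6) (by norm_num)⟩
  obtain ⟨b, hb, rfl⟩ : ∃ b : ℝ, 0 < b ∧ b ^ 6 = y :=
    ⟨y ^ ((6 : ℝ)⁻¹), by positivity, by
      simpa using rpow_inv_natCast_pow hy.le (n := 6) (by norm_num)⟩
  have hroot : (a ^ 6 / b ^ 6) ^ ((6 : ℝ)⁻¹) = a / b := by
    rw [← div_pow]
    simpa using pow_rpow_inv_natCast (div_pos ha hb).le (n := 6) (by norm_num)
  rw [hroot, div_pow, heronianMean_pow_six ha.le hb.le,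
    powerMeanTwoThirds_pow_six_sq ha.le hb.le, meanRatio]
  field_simp
  ring

/-- The quotient `He(x,y)/A_{2/3}(x,y)` is strictly decreasing in `x/y ≥ 1`. -/
lemma heronianMean_div_powerMeanTwoThirds_lt {x y z w : ℝ} (hx : 0 < x) (hy : 0 < y)
    (hw : 0 < w) (hwz : w ≤ z) (h : z / w < x / y) :
    heronianMean x y / powerMeanTwoThirds x y < heronianMean z w / powerMeanTwoThirds z w := by
  have hz : 0 < z := hw.trans_le hwz
  have h1 : 1 ≤ z / w := (one_le_div hw).2 hwz
  refine lt_of_pow_lt_pow_left₀ 2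
    (div_pos (heronianMean_pos hz hw) (powerMeanTwoThirds_pos hz hw)).le ?_
  rw [heronianMean_div_powerMeanTwoThirds_sq hx hy, heronianMean_div_powerMeanTwoThirds_sq hz hw]
  refine mul_lt_mul_of_pos_left (strictAntiOn_meanRatio ?_ ?_ ?_) (by norm_num)
  · exact one_le_rpow h1 (by norm_num)
  · exact one_le_rpow (h1.trans h.le) (by norm_num)
  · exact rpow_lt_rpow (by linarith) h (by norm_num)

/-- `He(x,y)/He(1-x,1-y) < A_{2/3}(x,y)/A_{2/3}(1-x,1-y)` for
`0 < x,y ≤ 1/2`, `x ≠ y`. -/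
theorem kyFan_heronian_lt_powerMeanTwoThirds :
    ∀ x y : ℝ, 0 < x → x ≤ 1 / 2 → 0 < y → y ≤ 1 / 2 → x ≠ y →
      heronianMean x y / heronianMean (1 - x) (1 - y) <
        powerMeanTwoThirds x y / powerMeanTwoThirds (1 - x) (1 - y) := by
  intro x y hx hx2 hy hy2 hxy
  wlog hlt : y < x generalizing x y
  · rw [heronianMean_comm x, heronianMean_comm (1 - x), powerMeanTwoThirds_comm x,
      powerMeanTwoThirds_comm (1 - x)]
    exact this y x hy hy2 hx hx2 hxy.symm (hxy.lt_of_le (not_lt.1 hlt))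
  have hx' : 0 < 1 - x := by linarith
  have hy' : 0 < 1 - y := by linarith
  have hratio : (1 - y) / (1 - x) < x / y := by
    rw [div_lt_div_iff₀ hx' hy]
    nlinarith
  have key := heronianMean_div_powerMeanTwoThirds_lt hx hy hx' (by linarith) hratio
  rw [heronianMean_comm (1 - y), powerMeanTwoThirds_comm (1 - y),
    div_lt_div_iff₀ (powerMeanTwoThirds_pos hx hy) (powerMeanTwoThirds_pos hx' hy')] at key
  rw [div_lt_div_iff₀ (heronianMean_pos hx' hy') (powerMeanTwoThirds_pos hx' hy')]
  linarith
end

section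
/- Let L(x,y) = (x - y)/(log x - log y) for x ≠ y, L(x,x) = x, be the logarithmic mean, and let A_{1/3}(x,y) = ((x^{1/3} + y^{1/3})/2)³ be the power mean of order 1/3. Then for all x,y with 0 < x,y ≤ 1/2 and x ≠ y, L(x,y)/L(1-x,1-y) < A_{1/3}(x,y)/A_{1/3}(1-x,1-y). -/
/-- The logarithmic mean. -/
noncomputable def logMean (x y : ℝ) : ℝ :=
  if x = y then x else (x - y) / (Real.log x - Real.log y)

/-- The power mean of order `1/3`. -/
noncomputable def powerMeanThird (x y : ℝ) : ℝ :=
  ((x ^ ((1 : ℝ) / 3) + y ^ ((1 : ℝ) / 3)) / 2) ^ 3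

theorem log_lt_of_one_lt {r : ℝ} (hr : 1 < r) :
    Real.log r < (r ^ 4 + r ^ 3 - r - 1) / (3 * (r ^ 3 + r)) := by
  have hd : ∀ s : ℝ, 0 < s →
      HasDerivAt (fun s : ℝ ↦ (s ^ 4 + s ^ 3 - s - 1) / (3 * (s ^ 3 + s)) - Real.log s)
        ((s - 1) ^ 4 * (s ^ 2 + s + 1) / (3 * (s ^ 3 + s) ^ 2)) s := by
    intro s hs
    have hne : 3 * (s ^ 3 + s) ≠ 0 := by positivity
    refine HasDerivAt.congr_deriv
      ((((((hasDerivAt_pow 4 s).add (hasDerivAt_pow 3 s)).sub (hasDerivAt_id s)).sub_const 1).div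
        (((hasDerivAt_pow 3 s).add (hasDerivAt_id s)).const_mul 3) hne).sub
          (Real.hasDerivAt_log hs.ne')) ?_
    simp only [Pi.add_apply, Pi.sub_apply, id]
    have : s ^ 2 + 1 ≠ 0 := by positivity
    have : s ^ 3 + s ≠ 0 := by positivity
    field_simp
    ring
  have hmono : StrictMonoOn
      (fun s : ℝ ↦ (s ^ 4 + s ^ 3 - s - 1) / (3 * (s ^ 3 + s)) - Real.log s) (Set.Ici 1) := by
    refine strictMonoOn_of_deriv_pos (convex_Ici 1)
      (fun s hs ↦ (hd s (zero_lt_one.trans_le hs)).continuousAt.continuousWithinAt) ?_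
    intro s hs
    rw [interior_Ici, Set.mem_Ioi] at hs
    have hs0 : 0 < s := by linarith
    have hs1 : 0 < s - 1 := by linarith
    rw [(hd s hs0).deriv]
    positivity
  have h := hmono Set.self_mem_Ici hr.le hr
  norm_num at h
  exact h

theorem strictMonoOn_log_mul_cube_div :
    StrictMonoOn (fun r : ℝ ↦ Real.log r * (r + 1) ^ 3 / (r ^ 3 - 1)) (Set.Ioi 1) := by
  have hpos : ∀ r : ℝ, 1 < r → 0 < r ^ 3 - 1 := fun r hr ↦
    sub_pos.2 (one_lt_pow₀ hr three_ne_zero)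
  have hd : ∀ r : ℝ, 1 < r →
      HasDerivAt (fun r : ℝ ↦ Real.log r * (r + 1) ^ 3 / (r ^ 3 - 1))
        (3 * (r + 1) ^ 2 * (r ^ 2 + 1) *
          ((r ^ 4 + r ^ 3 - r - 1) / (3 * (r ^ 3 + r)) - Real.log r) / (r ^ 3 - 1) ^ 2) r := by
    intro r hr
    have hr0 : 0 < r := by linarith
    have hne := (hpos r hr).ne'
    refine HasDerivAt.congr_deriv
      (((Real.hasDerivAt_log hr0.ne').mul (((hasDerivAt_id r).add_const 1).pow 3)).div
        ((hasDerivAt_pow 3 r).sub_const 1) hne) ?_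
    simp only [Pi.mul_apply, Pi.pow_apply, id]
    have : r ^ 2 + 1 ≠ 0 := by positivity
    rw [show r ^ 3 + r = r * (r ^ 2 + 1) by ring]
    field_simp
    push_cast
    ring
  refine strictMonoOn_of_deriv_pos (convex_Ioi 1)
    (fun r hr ↦ (hd r hr).continuousAt.continuousWithinAt) ?_
  intro r hr
  rw [interior_Ioi, Set.mem_Ioi] at hr
  have hr0 : 0 < r := by linarith
  have := hpos r hr
  have := sub_pos.2 (log_lt_of_one_lt hr)
  rw [(hd r hr).deriv]
  positivity

theorem logMean_comm (x y : ℝ) : logMean x y = logMean y x := by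
  unfold logMean
  by_cases h : x = y
  · simp [h]
  · rw [if_neg h, if_neg (Ne.symm h), ← neg_div_neg_eq, neg_sub, neg_sub]

theorem powerMeanThird_comm (x y : ℝ) : powerMeanThird x y = powerMeanThird y x := by
  unfold powerMeanThird
  rw [add_comm]

theorem logMean_pos {x y : ℝ} (hy : 0 < y) (hxy : y < x) : 0 < logMean x y := by
  rw [logMean, if_neg hxy.ne']
  exact div_pos (sub_pos.2 hxy) (sub_pos.2 (Real.log_lt_log hy hxy))

theorem powerMeanThird_pos {x y : ℝ} (hx : 0 < x) (hy : 0 < y) : 0 < powerMeanThird x y := by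
  unfold powerMeanThird
  positivity

theorem powerMeanThird_div_logMean {x y : ℝ} (hy : 0 < y) (hxy : y < x) :
    powerMeanThird x y / logMean x y =
      3 / 8 * (Real.log ((x / y) ^ ((1 : ℝ) / 3)) * ((x / y) ^ ((1 : ℝ) / 3) + 1) ^ 3 /
        (((x / y) ^ ((1 : ℝ) / 3)) ^ 3 - 1)) := by
  have hx : 0 < x := hy.trans hxy
  have hcube : ∀ z : ℝ, 0 < z → (z ^ ((1 : ℝ) / 3)) ^ 3 = z := fun z hz ↦ by
    rw [← Real.rpow_natCast, ← Real.rpow_mul hz.le]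
    norm_num
  rw [logMean, if_neg hxy.ne', powerMeanThird, Real.log_rpow (div_pos hx hy),
    Real.log_div hx.ne' hy.ne', hcube _ (div_pos hx hy), Real.div_rpow hx.le hy.le]
  have hb : 0 < y ^ ((1 : ℝ) / 3) := by positivity
  have hby := hcube y hy
  set a := x ^ ((1 : ℝ) / 3)
  set b := y ^ ((1 : ℝ) / 3)
  have hl : Real.log x - Real.log y ≠ 0 := (sub_pos.2 (Real.log_lt_log hy hxy)).ne'
  have hs : x - y ≠ 0 := (sub_pos.2 hxy).ne'
  have hab : a / b + 1 = (a + b) / b := by field_simp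
  have hxy' : x / y - 1 = (x - y) / y := by field_simp
  rw [hab, hxy', div_pow (a + b) b, hby]
  field_simp
  norm_num

theorem kyFan_logMean_lt_of_lt {x y : ℝ} (hx : x ≤ 1 / 2) (hy : 0 < y) (hxy : y < x) :
    logMean x y / logMean (1 - x) (1 - y) <
      powerMeanThird x y / powerMeanThird (1 - x) (1 - y) := by
  have hx' : 0 < 1 - x := by linarith
  have hxy' : 1 - x < 1 - y := by linarith
  rw [logMean_comm (1 - x), powerMeanThird_comm (1 - x)]
  have hone : 1 < (1 - y) / (1 - x) := (one_lt_div hx').2 hxy'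
  have hlt : (1 - y) / (1 - x) < x / y := by
    rw [div_lt_div_iff₀ hx' hy]
    nlinarith
  have hone' : 1 < ((1 - y) / (1 - x)) ^ ((1 : ℝ) / 3) := Real.one_lt_rpow hone (by norm_num)
  have hlt' : ((1 - y) / (1 - x)) ^ ((1 : ℝ) / 3) < (x / y) ^ ((1 : ℝ) / 3) :=
    Real.rpow_lt_rpow (zero_le_one.trans hone.le) hlt (by norm_num)
  have key : powerMeanThird (1 - y) (1 - x) / logMean (1 - y) (1 - x) <
      powerMeanThird x y / logMean x y := by
    rw [powerMeanThird_div_logMean hx' hxy', powerMeanThird_div_logMean hy hxy]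
    exact mul_lt_mul_of_pos_left
      (strictMonoOn_log_mul_cube_div hone' (hone'.trans hlt') hlt') (by norm_num)
  have hL := logMean_pos hx' hxy'
  rw [div_lt_div_iff₀ hL (logMean_pos hy hxy)] at key
  rw [div_lt_div_iff₀ hL (powerMeanThird_pos (hx'.trans hxy') hx')]
  linarith

/-- `L(x,y)/L(1-x,1-y) < A_{1/3}(x,y)/A_{1/3}(1-x,1-y)` for
`0 < x,y ≤ 1/2`, `x ≠ y`. -/
theorem kyFan_logMean_lt_powerMeanThird :
    ∀ x y : ℝ, 0 < x → x ≤ 1 / 2 → 0 < y → y ≤ 1 / 2 → x ≠ y →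
      logMean x y / logMean (1 - x) (1 - y) <
        powerMeanThird x y / powerMeanThird (1 - x) (1 - y) := by
  intro x y hx hx2 hy hy2 hne
  rcases hne.lt_or_gt with h | h
  · rw [logMean_comm x, logMean_comm (1 - x), powerMeanThird_comm x, powerMeanThird_comm (1 - x)]
    exact kyFan_logMean_lt_of_lt hy2 hx h
  · exact kyFan_logMean_lt_of_lt hx2 hy h
end

section
/- Let S_sinh(x,y) = |x-y|/(2·sinh(|x-y|/(x+y))) for x ≠ y, S_sinh(x,x) = x, and let A(x,y) = (x+y)/2 be the arithmetic mean. Then for all x,y with 0 < x,y ≤ 1/2, S_sinh(x,y)/S_sinh(1-x,1-y) ≤ A(x,y)/A(1-x,1-y). -/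
/-- The mean with Seiffert function `sinh`. -/
noncomputable def sinhMean (x y : ℝ) : ℝ :=
  if x = y then x else |x - y| / (2 * Real.sinh (|x - y| / (x + y)))

theorem convexOn_sinh_Ici : ConvexOn ℝ (Set.Ici 0) Real.sinh := by
  refine MonotoneOn.convexOn_of_deriv (convex_Ici 0) Real.continuous_sinh.continuousOn
    Real.differentiable_sinh.differentiableOn ?_
  rw [interior_Ici, Real.deriv_sinh]
  intro a ha b hb hab
  rw [Real.cosh_le_cosh, abs_of_pos ha, abs_of_pos hb]
  exact hab

theorem sinh_mul_le_mul_sinh {c a : ℝ} (hc : 0 ≤ c) (hc' : c ≤ 1) (ha : 0 ≤ a) :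
    Real.sinh (c * a) ≤ c * Real.sinh a := by
  have h := convexOn_sinh_Ici.2 (Set.mem_Ici.2 le_rfl) (Set.mem_Ici.2 ha)
    (sub_nonneg.2 hc') hc (sub_add_cancel 1 c)
  simpa using h

/-- `S_sinh(x,y)/S_sinh(1-x,1-y) ≤ A(x,y)/A(1-x,1-y)` for
`0 < x,y ≤ 1/2`, where `A` is the arithmetic mean. -/
theorem kyFan_sinhMean_le_arith :
    ∀ x y : ℝ, 0 < x → x ≤ 1 / 2 → 0 < y → y ≤ 1 / 2 →
      sinhMean x y / sinhMean (1 - x) (1 - y) ≤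
        ((x + y) / 2) / (((1 - x) + (1 - y)) / 2) := by
  intro x y hx hx' hy hy'
  rcases eq_or_ne x y with rfl | hxy
  · simp [sinhMean]
  have hd : 0 < |x - y| := abs_pos.2 (sub_ne_zero.2 hxy)
  have hs : 0 < x + y := by linarith
  have hs' : 0 < 1 - x + (1 - y) := by linarith
  have hxy' : 1 - x ≠ 1 - y := fun h => hxy (by linarith)
  have hd' : |1 - x - (1 - y)| = |x - y| := by
    rw [abs_sub_comm x y]
    congr 1
    ring
  have key := sinh_mul_le_mul_sinh (c := (x + y) / (1 - x + (1 - y))) (a := |x - y| / (x + y))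
    (by positivity) ((div_le_one hs').2 (by linarith)) (by positivity)
  have harg : (x + y) / (1 - x + (1 - y)) * (|x - y| / (x + y)) =
      |x - y| / (1 - x + (1 - y)) := by
    field_simp
  rw [harg] at key
  have hsinh : 0 < Real.sinh (|x - y| / (x + y)) := Real.sinh_pos_iff.2 (by positivity)
  rw [sinhMean, sinhMean, if_neg hxy, if_neg hxy', hd', div_div_div_cancel_right₀ two_ne_zero,
    div_div_div_cancel_left' _ _ hd.ne', mul_div_mul_left _ _ two_ne_zero]
  exact (div_le_iff₀ hsinh).2 key
end

section
/- Let P(x,y) = |x-y|/(2·arcsin(|x-y|/(x+y))) for x ≠ y, P(x,x) = x, be the first Seiffert mean, and A_{1/2}(x,y) = ((√x + √y)/2)² the power mean of order 1/2. Then for all x,y with 0 < x,y ≤ 1/2 and x ≠ y, A_{1/2}(x,y)/A_{1/2}(1-x,1-y) < P(x,y)/P(1-x,1-y). -/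
/-- The first Seiffert mean. -/
noncomputable def seiffertP (x y : ℝ) : ℝ :=
  if x = y then x else |x - y| / (2 * Real.arcsin (|x - y| / (x + y)))

/-- The function `sin t / t` is strictly decreasing on `(0, π]`. -/
theorem mul_sin_lt_mul_sin {p q : ℝ} (hp : 0 < p) (hpq : p < q) (hq : q ≤ Real.pi) :
    p * Real.sin q < q * Real.sin p := by
  have hq0 : 0 < q := hp.trans hpq
  have h := strictConcaveOn_sin_Icc.2 ⟨le_rfl, Real.pi_pos.le⟩ ⟨hq0.le, hq⟩ hq0.ne
    (sub_pos.2 ((div_lt_one hq0).2 hpq)) (div_pos hp hq0) (sub_add_cancel 1 (p / q))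
  simp only [smul_eq_mul, mul_zero, Real.sin_zero, zero_add, div_mul_cancel₀ p hq0.ne'] at h
  rw [div_mul_eq_mul_div, div_lt_iff₀ hq0] at h
  linarith

/-- The function `tan t / t` is strictly increasing on `(0, π / 2)`, written without division. -/
theorem mul_sin_mul_cos_lt {a b : ℝ} (ha : 0 < a) (hab : a < b) (hb : a + b ≤ Real.pi) :
    b * (Real.sin a * Real.cos b) < a * (Real.sin b * Real.cos a) := by
  have h := mul_sin_lt_mul_sin (sub_pos.2 hab) (show b - a < a + b by linarith) hb
  rw [Real.sin_sub, Real.sin_add] at h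
  linarith

theorem powerMeanHalf_eq_cos_sq {x y : ℝ} (hx : 0 < x) (hy : 0 < y) :
    powerMeanHalf x y =
      (x + y) / 2 * Real.cos (Real.arcsin (|x - y| / (x + y)) / 2) ^ 2 := by
  have hs : 0 < x + y := add_pos hx hy
  have hsx := Real.sq_sqrt hx.le
  have hsy := Real.sq_sqrt hy.le
  have hroot : √(1 - (|x - y| / (x + y)) ^ 2) = 2 * (√x * √y) / (x + y) := by
    rw [Real.sqrt_eq_iff_mul_self_eq_of_pos (by positivity)]
    rw [div_pow, sq_abs]
    field_simp
    rw [hsx, hsy]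
    ring
  rw [Real.cos_sq, mul_div_cancel₀ _ (two_ne_zero' ℝ), Real.cos_arcsin, hroot, powerMeanHalf]
  field_simp
  linear_combination hsx + hsy

/-- `A_{1/2}(x,y)/A_{1/2}(1-x,1-y) < P(x,y)/P(1-x,1-y)` for
`0 < x,y ≤ 1/2`, `x ≠ y`. -/
theorem kyFan_powerMeanHalf_lt_seiffertP :
    ∀ x y : ℝ, 0 < x → x ≤ 1 / 2 → 0 < y → y ≤ 1 / 2 → x ≠ y →
      powerMeanHalf x y / powerMeanHalf (1 - x) (1 - y) <
        seiffertP x y / seiffertP (1 - x) (1 - y) := by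
  intro x y hx hx' hy hy' hxy
  have habs : |1 - x - (1 - y)| = |x - y| := by
    rw [sub_sub_sub_cancel_left, abs_sub_comm]
  have hxy' : 1 - x ≠ 1 - y := fun h => hxy (sub_right_injective h)
  rw [powerMeanHalf_eq_cos_sq hx hy, powerMeanHalf_eq_cos_sq (by linarith) (by linarith),
    seiffertP, seiffertP, if_neg hxy, if_neg hxy', habs]
  have hd : 0 < |x - y| := abs_pos.2 (sub_ne_zero.2 hxy)
  have hds : |x - y| < x + y := abs_sub_lt_iff.2 ⟨by linarith, by linarith⟩
  have hs : 0 < x + y := add_pos hx hy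
  have hlt : x + y < 1 - x + (1 - y) := by
    rcases lt_or_gt_of_ne hxy with h | h <;> linarith
  generalize |x - y| = d at *
  generalize x + y = s at *
  generalize 1 - x + (1 - y) = t at *
  have ht : 0 < t := hs.trans hlt
  have hvu : d / t < d / s := div_lt_div_of_pos_left hd hs hlt
  have hv1 : d / s < 1 := (div_lt_one hs).2 hds
  have hu0 : 0 < d / t := div_pos hd ht
  obtain ⟨a, ha⟩ : ∃ a, a = Real.arcsin (d / t) / 2 := ⟨_, rfl⟩
  obtain ⟨b, hb⟩ : ∃ b, b = Real.arcsin (d / s) / 2 := ⟨_, rfl⟩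
  have ha0 : 0 < a := by rw [ha]; exact half_pos (Real.arcsin_pos.2 hu0)
  have hab : a < b := by
    rw [ha, hb]
    exact div_lt_div_of_pos_right
      (Real.arcsin_lt_arcsin (by linarith) hvu hv1.le) two_pos
  have hbpi : b ≤ Real.pi / 4 := by
    have := Real.arcsin_le_pi_div_two (d / s)
    linarith
  have hpi := Real.pi_pos
  have hsin_a : 2 * Real.sin a * Real.cos a = d / t := by
    rw [← Real.sin_two_mul, ha, mul_div_cancel₀ _ (two_ne_zero' ℝ),
      Real.sin_arcsin (by linarith) (by linarith)]
  have hsin_b : 2 * Real.sin b * Real.cos b = d / s := by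
    rw [← Real.sin_two_mul, hb, mul_div_cancel₀ _ (two_ne_zero' ℝ),
      Real.sin_arcsin (by linarith) (by linarith)]
  have hcos_a : 0 < Real.cos a := Real.cos_pos_of_mem_Ioo ⟨by linarith, by linarith⟩
  have hcos_b : 0 < Real.cos b := Real.cos_pos_of_mem_Ioo ⟨by linarith, by linarith⟩
  have hb0 : 0 < b := ha0.trans hab
  have hsinb0 : 0 < Real.sin b := Real.sin_pos_of_pos_of_lt_pi hb0 (by linarith)
  have key := mul_sin_mul_cos_lt ha0 hab (by linarith)
  rw [← ha, ← hb, show Real.arcsin (d / t) = 2 * a by linarith,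
    show Real.arcsin (d / s) = 2 * b by linarith]
  have hratio : s * (Real.sin b * Real.cos b) = t * (Real.sin a * Real.cos a) := by
    rw [eq_div_iff ht.ne'] at hsin_a
    rw [eq_div_iff hs.ne'] at hsin_b
    linarith
  have hleft : s / 2 * Real.cos b ^ 2 / (t / 2 * Real.cos a ^ 2) =
      Real.sin a * Real.cos b / (Real.sin b * Real.cos a) := by
    rw [div_eq_div_iff (by positivity) (by positivity)]
    linear_combination Real.cos b * Real.cos a / 2 * hratio
  have hright : d / (2 * (2 * b)) / (d / (2 * (2 * a))) = a / b := by
    field_simp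
  rw [hleft, hright, div_lt_div_iff₀ (by positivity) hb0]
  linarith
end

section
/- Let S_tanh, T, S_sin, NS, A be the symmetric homogeneous means whose Seiffert functions are tanh, arctan, sin, arsinh and the identity respectively, i.e. each mean equals |x-y|/(2·f(|x-y|/(x+y))) for x ≠ y with the corresponding f (so T is the second Seiffert mean, NS the Neuman–Sándor mean and A the arithmetic mean). Then for all x,y with 0 < x,y ≤ 1/2, 1/S_tanh(x,y) - 1/S_tanh(1-x,1-y) ≤ 1/T(x,y) - 1/T(1-x,1-y) ≤ 1/S_sin(x,y) - 1/S_sin(1-x,1-y) ≤ 1/NS(x,y) - 1/NS(1-x,1-y) ≤ 1/A(x,y) - 1/A(1-x,1-y). -/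
/-- The symmetric homogeneous mean associated with a Seiffert function `f`. -/
noncomputable def seiffertMean (f : ℝ → ℝ) (x y : ℝ) : ℝ :=
  if x = y then x else |x - y| / (2 * f (|x - y| / (x + y)))

/-- If `f' ≤ g'` on `[0, 1]`, the harmonic Ky Fan differences of the Seiffert means of `f` and `g`
are ordered. -/
theorem one_div_seiffertMean_sub_le_of_deriv_le {f g f' g' : ℝ → ℝ}
    (hf : ∀ z, HasDerivAt f (f' z) z) (hg : ∀ z, HasDerivAt g (g' z) z)
    (hle : ∀ z, 0 ≤ z → z ≤ 1 → f' z ≤ g' z) {x y : ℝ}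
    (hx : 0 < x) (hx2 : x ≤ 1 / 2) (hy : 0 < y) (hy2 : y ≤ 1 / 2) :
    1 / seiffertMean f x y - 1 / seiffertMean f (1 - x) (1 - y) ≤
      1 / seiffertMean g x y - 1 / seiffertMean g (1 - x) (1 - y) := by
  by_cases hxy : x = y
  · simp [seiffertMean, hxy]
  have hxy' : 1 - x ≠ 1 - y := fun h => hxy (by linarith)
  have habs : |1 - x - (1 - y)| = |x - y| := by
    rw [abs_sub_comm x y]; congr 1; ring
  have hd : 0 < |x - y| := abs_pos.mpr (sub_ne_zero.mpr hxy)
  have hmono : MonotoneOn (fun z => g z - f z) (Set.Icc 0 1) := by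
    refine monotoneOn_of_hasDerivWithinAt_nonneg (f' := fun z => g' z - f' z) (convex_Icc 0 1)
      (fun z _ => ((hg z).sub (hf z)).continuousAt.continuousWithinAt)
      (fun z _ => ((hg z).sub (hf z)).hasDerivWithinAt) fun z hz => ?_
    have hz' := interior_subset hz
    exact sub_nonneg.mpr (hle z hz'.1 hz'.2)
  have hzz : |x - y| / (1 - x + (1 - y)) ≤ |x - y| / (x + y) :=
    div_le_div_of_nonneg_left hd.le (by linarith) (by linarith)
  have hz0 : 0 ≤ |x - y| / (1 - x + (1 - y)) := div_nonneg hd.le (by linarith)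
  have hz1 : |x - y| / (x + y) ≤ 1 := by
    rw [div_le_one (by linarith), abs_le]
    constructor <;> linarith
  have key := hmono ⟨hz0, hzz.trans hz1⟩ ⟨hz0.trans hzz, hz1⟩ hzz
  simp only [seiffertMean, if_neg hxy, if_neg hxy', habs, one_div_div]
  rw [← sub_div, ← sub_div]
  exact div_le_div_of_nonneg_right (by linarith) hd.le

theorem hasDerivAt_tanh_one_div_cosh_sq (z : ℝ) :
    HasDerivAt Real.tanh (1 / Real.cosh z ^ 2) z := by
  have h := (Real.hasDerivAt_sinh z).div (Real.hasDerivAt_cosh z) (Real.cosh_pos z).ne'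
  have heq : Real.tanh = Real.sinh / Real.cosh := by
    ext t
    exact Real.tanh_eq_sinh_div_cosh t
  have hnum : Real.cosh z * Real.cosh z - Real.sinh z * Real.sinh z = 1 := by
    linarith [Real.cosh_sq z, sq (Real.cosh z), sq (Real.sinh z)]
  rwa [hnum, ← heq] at h

theorem one_div_cosh_sq_le_one_div_one_add_sq {z : ℝ} (hz : 0 ≤ z) :
    1 / Real.cosh z ^ 2 ≤ 1 / (1 + z ^ 2) := by
  apply one_div_le_one_div_of_le (by positivity)
  have h := Real.self_le_sinh_iff.mpr hz
  nlinarith [Real.cosh_sq z]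

theorem one_div_one_add_sq_le_cos {z : ℝ} (hz : 0 ≤ z) (hz1 : z ≤ 1) :
    1 / (1 + z ^ 2) ≤ Real.cos z := by
  refine le_trans ?_ (Real.one_sub_sq_div_two_le_cos (x := z))
  rw [div_le_iff₀ (by positivity)]
  nlinarith [mul_nonneg (sq_nonneg z) (sub_nonneg.mpr (pow_le_one₀ (n := 2) hz hz1))]

theorem cos_le_inv_sqrt_one_add_sq {z : ℝ} (hz : 0 ≤ z) (hz1 : z ≤ 1) :
    Real.cos z ≤ (√(1 + z ^ 2))⁻¹ := by
  have h := Real.cos_le_one_div_sqrt_sq_add_one (x := z)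
    (by linarith [Real.pi_gt_three]) (by linarith [Real.pi_gt_three])
  rwa [one_div, add_comm] at h

theorem inv_sqrt_one_add_sq_le_one (z : ℝ) : (√(1 + z ^ 2))⁻¹ ≤ 1 :=
  inv_le_one_of_one_le₀ (Real.one_le_sqrt.mpr (by nlinarith [sq_nonneg z]))

/-- the chain of harmonic Ky Fan inequalities
`1/S_tanh - 1/S_tanh' ≤ 1/T - 1/T' ≤ 1/S_sin - 1/S_sin' ≤ 1/NS - 1/NS'
  ≤ 1/A - 1/A'`
for `0 < x,y ≤ 1/2`, where the means have Seiffert functions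
`tanh, arctan, sin, arsinh` and the identity respectively. -/
theorem harmonicKyFan_chain_upper :
    ∀ x y : ℝ, 0 < x → x ≤ 1 / 2 → 0 < y → y ≤ 1 / 2 →
      1 / seiffertMean Real.tanh x y - 1 / seiffertMean Real.tanh (1 - x) (1 - y) ≤
        1 / seiffertMean Real.arctan x y - 1 / seiffertMean Real.arctan (1 - x) (1 - y) ∧
      1 / seiffertMean Real.arctan x y - 1 / seiffertMean Real.arctan (1 - x) (1 - y) ≤
        1 / seiffertMean Real.sin x y - 1 / seiffertMean Real.sin (1 - x) (1 - y) ∧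
      1 / seiffertMean Real.sin x y - 1 / seiffertMean Real.sin (1 - x) (1 - y) ≤
        1 / seiffertMean Real.arsinh x y - 1 / seiffertMean Real.arsinh (1 - x) (1 - y) ∧
      1 / seiffertMean Real.arsinh x y - 1 / seiffertMean Real.arsinh (1 - x) (1 - y) ≤
        1 / seiffertMean id x y - 1 / seiffertMean id (1 - x) (1 - y) := by
  intro x y hx hx2 hy hy2
  refine ⟨?_, ?_, ?_, ?_⟩
  · exact one_div_seiffertMean_sub_le_of_deriv_le hasDerivAt_tanh_one_div_cosh_sq
      Real.hasDerivAt_arctan (fun z hz _ => one_div_cosh_sq_le_one_div_one_add_sq hz)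
      hx hx2 hy hy2
  · exact one_div_seiffertMean_sub_le_of_deriv_le Real.hasDerivAt_arctan Real.hasDerivAt_sin
      (fun z hz hz1 => one_div_one_add_sq_le_cos hz hz1) hx hx2 hy hy2
  · exact one_div_seiffertMean_sub_le_of_deriv_le Real.hasDerivAt_sin Real.hasDerivAt_arsinh
      (fun z hz hz1 => cos_le_inv_sqrt_one_add_sq hz hz1) hx hx2 hy hy2
  · exact one_div_seiffertMean_sub_le_of_deriv_le Real.hasDerivAt_arsinh hasDerivAt_id
      (fun z _ _ => inv_sqrt_one_add_sq_le_one z) hx hx2 hy hy2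
end

section
/- Let A, S_sinh, S_tan, P, L be the symmetric homogeneous means whose Seiffert functions are the identity, sinh, tan, arcsin and artanh respectively (so P is the first Seiffert mean and L the logarithmic mean). Then for all x,y with 0 < x,y ≤ 1/2, one has 1/A(x,y) - 1/A(1-x,1-y) ≤ 1/S_sinh(x,y) - 1/S_sinh(1-x,1-y), and both 1/S_sinh(x,y) - 1/S_sinh(1-x,1-y) ≤ 1/S_tan(x,y) - 1/S_tan(1-x,1-y) ≤ 1/L(x,y) - 1/L(1-x,1-y) and 1/S_sinh(x,y) - 1/S_sinh(1-x,1-y) ≤ 1/P(x,y) - 1/P(1-x,1-y) ≤ 1/L(x,y) - 1/L(1-x,1-y). -/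
/-- The inverse hyperbolic tangent, `artanh z = (1/2) log((1+z)/(1-z))`. -/
noncomputable def artanh (z : ℝ) : ℝ :=
  (1 / 2) * Real.log ((1 + z) / (1 - z))

lemma one_div_seiffertMean (f : ℝ → ℝ) {x y : ℝ} (h : x ≠ y) :
    1 / seiffertMean f x y = 2 * f (|x - y| / (x + y)) / |x - y| := by
  rw [seiffertMean, if_neg h, one_div_div]

lemma sub_le_sub_of_hasDerivAt_le {f g f' g' : ℝ → ℝ} {s : Set ℝ} (hs : Convex ℝ s)
    (hf : ∀ z ∈ s, HasDerivAt f (f' z) z) (hg : ∀ z ∈ s, HasDerivAt g (g' z) z)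
    (hle : ∀ z ∈ s, f' z ≤ g' z) {a b : ℝ} (ha : a ∈ s) (hb : b ∈ s) (hab : a ≤ b) :
    f b - f a ≤ g b - g a := by
  have hd : ∀ z ∈ s, HasDerivAt (fun z => g z - f z) (g' z - f' z) z :=
    fun z hz => (hg z hz).sub (hf z hz)
  have hmono : MonotoneOn (fun z => g z - f z) s := by
    refine monotoneOn_of_deriv_nonneg hs
      (fun z hz => (hd z hz).continuousAt.continuousWithinAt)
      (fun z hz => (hd z (interior_subset hz)).differentiableAt.differentiableWithinAt)
      fun z hz => ?_
    rw [(hd z (interior_subset hz)).deriv]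
    exact sub_nonneg.2 (hle z (interior_subset hz))
  have := hmono ha hb hab
  simp only at this
  linarith

/-- A pointwise comparison of the derivatives of two Seiffert functions on `(0, 1)` yields a
harmonic Ky Fan inequality between the associated means. -/
lemma one_div_seiffertMean_sub_le {f g f' g' : ℝ → ℝ}
    (hf : ∀ z ∈ Set.Ioo (0 : ℝ) 1, HasDerivAt f (f' z) z)
    (hg : ∀ z ∈ Set.Ioo (0 : ℝ) 1, HasDerivAt g (g' z) z)
    (hle : ∀ z ∈ Set.Ioo (0 : ℝ) 1, f' z ≤ g' z) {x y : ℝ}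
    (hx0 : 0 < x) (hx : x ≤ 1 / 2) (hy0 : 0 < y) (hy : y ≤ 1 / 2) :
    1 / seiffertMean f x y - 1 / seiffertMean f (1 - x) (1 - y) ≤
      1 / seiffertMean g x y - 1 / seiffertMean g (1 - x) (1 - y) := by
  by_cases hxy : x = y
  · simp [seiffertMean, hxy]
  have hd : 0 < |x - y| := abs_pos.2 (sub_ne_zero.2 hxy)
  have hd' : |(1 - x) - (1 - y)| = |x - y| := by
    rw [abs_sub_comm x y]; congr 1; ring
  have hlt : |x - y| < x + y := abs_sub_lt_iff.2 ⟨by linarith, by linarith⟩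
  have hb : |x - y| / (x + y) ∈ Set.Ioo (0 : ℝ) 1 :=
    ⟨by positivity, (div_lt_one (by positivity)).2 hlt⟩
  have hab : |x - y| / ((1 - x) + (1 - y)) ≤ |x - y| / (x + y) := by
    gcongr <;> linarith
  have ha : |x - y| / ((1 - x) + (1 - y)) ∈ Set.Ioo (0 : ℝ) 1 :=
    ⟨div_pos hd (by linarith), hab.trans_lt hb.2⟩
  have key := sub_le_sub_of_hasDerivAt_le (convex_Ioo 0 1) hf hg hle ha hb hab
  have hxy' : 1 - x ≠ 1 - y := fun h => hxy (by linarith)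
  rw [one_div_seiffertMean f hxy, one_div_seiffertMean f hxy', one_div_seiffertMean g hxy,
    one_div_seiffertMean g hxy', hd', ← sub_div, ← sub_div]
  gcongr ?_ / _
  linarith

lemma hasDerivAt_artanh {z : ℝ} (hz : z ∈ Set.Ioo (0 : ℝ) 1) :
    HasDerivAt artanh (1 / (1 - z ^ 2)) z := by
  obtain ⟨h0, h1⟩ := hz
  have hp : 1 + z ≠ 0 := by linarith
  have hm : 1 - z ≠ 0 := by linarith
  have h := ((((hasDerivAt_id z).const_add 1).div ((hasDerivAt_id z).const_sub 1) hm).log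
    (div_ne_zero hp hm)).const_mul (1 / 2)
  refine HasDerivAt.congr_deriv (f := artanh) h ?_
  have hq : 1 - z ^ 2 ≠ 0 := by
    rw [show 1 - z ^ 2 = (1 + z) * (1 - z) by ring]
    exact mul_ne_zero hp hm
  simp only [id, Pi.div_apply]
  field_simp
  ring

lemma cos_pos_of_mem_Ioo_zero_one {z : ℝ} (hz : z ∈ Set.Ioo (0 : ℝ) 1) : 0 < Real.cos z :=
  Real.cos_pos_of_mem_Ioo
    ⟨by linarith [hz.1, Real.pi_pos], by linarith [hz.2, Real.pi_gt_three]⟩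

lemma cosh_le_one_add_sq {z : ℝ} (hz : z ∈ Set.Ioo (0 : ℝ) 1) : Real.cosh z ≤ 1 + z ^ 2 := by
  have hsq : z ^ 2 < 1 := by nlinarith [hz.1, hz.2]
  have hexp : Real.exp (z ^ 2 / 2) * (1 - z ^ 2 / 2) ≤ 1 := by
    have h := mul_le_mul_of_nonneg_left (Real.one_sub_le_exp_neg (z ^ 2 / 2))
      (Real.exp_nonneg (z ^ 2 / 2))
    rwa [← Real.exp_add, add_neg_cancel, Real.exp_zero] at h
  refine (Real.cosh_le_exp_half_sq z).trans ?_
  refine le_of_mul_le_mul_right (hexp.trans ?_) (show 0 < 1 - z ^ 2 / 2 by linarith)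
  nlinarith [sq_nonneg z]

lemma one_add_sq_le_one_div_cos_sq {z : ℝ} (hz : z ∈ Set.Ioo (0 : ℝ) 1) :
    1 + z ^ 2 ≤ 1 / Real.cos z ^ 2 := by
  have hc := cos_pos_of_mem_Ioo_zero_one hz
  have h := Real.cos_le_one_div_sqrt_sq_add_one (x := z)
    (by linarith [hz.1, Real.pi_pos]) (by linarith [hz.2, Real.pi_gt_three])
  have hsq := pow_le_pow_left₀ hc.le h 2
  rw [div_pow, one_pow, Real.sq_sqrt (by positivity)] at hsq
  rw [le_div_iff₀ (by positivity), mul_comm, add_comm]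
  exact (le_div_iff₀ (by positivity)).1 hsq

lemma one_div_cos_sq_le {z : ℝ} (hz : z ∈ Set.Ioo (0 : ℝ) 1) :
    1 / Real.cos z ^ 2 ≤ 1 / (1 - z ^ 2) := by
  have hsq : z ^ 2 < 1 := by nlinarith [hz.1, hz.2]
  refine one_div_le_one_div_of_le (by linarith) ?_
  have := pow_le_pow_left₀ (abs_nonneg _) (Real.abs_sin_le_abs (x := z)) 2
  rw [sq_abs, sq_abs] at this
  linarith [Real.sin_sq_add_cos_sq z]

lemma cosh_le_one_div_sqrt {z : ℝ} (hz : z ∈ Set.Ioo (0 : ℝ) 1) :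
    Real.cosh z ≤ 1 / √(1 - z ^ 2) := by
  have hsq : z ^ 2 < 1 := by nlinarith [hz.1, hz.2]
  have hs : 0 < √(1 - z ^ 2) := Real.sqrt_pos.2 (by linarith)
  have hexp : √(1 - z ^ 2) ≤ Real.exp (-(z ^ 2 / 2)) := by
    rw [Real.sqrt_le_left (Real.exp_nonneg _), ← Real.exp_nat_mul]
    convert Real.one_sub_le_exp_neg (z ^ 2) using 2
    push_cast
    ring
  rw [le_div_iff₀ hs]
  calc Real.cosh z * √(1 - z ^ 2)
      ≤ Real.exp (z ^ 2 / 2) * Real.exp (-(z ^ 2 / 2)) := by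
        gcongr
        exact Real.cosh_le_exp_half_sq z
    _ = 1 := by rw [← Real.exp_add, add_neg_cancel, Real.exp_zero]

lemma one_div_sqrt_le {z : ℝ} (hz : z ∈ Set.Ioo (0 : ℝ) 1) :
    1 / √(1 - z ^ 2) ≤ 1 / (1 - z ^ 2) := by
  have hsq : z ^ 2 < 1 := by nlinarith [hz.1, hz.2]
  refine one_div_le_one_div_of_le (by linarith) (Real.le_sqrt_of_sq_le ?_)
  nlinarith [sq_nonneg z]

/-- for `0 < x,y ≤ 1/2`, with `A, S_sinh, S_tan, P, L` the means
with Seiffert functions `id, sinh, tan, arcsin, artanh` respectively: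
`1/A - 1/A' ≤ 1/S_sinh - 1/S_sinh'`, and both
`1/S_sinh - 1/S_sinh' ≤ 1/S_tan - 1/S_tan' ≤ 1/L - 1/L'` and
`1/S_sinh - 1/S_sinh' ≤ 1/P - 1/P' ≤ 1/L - 1/L'`. -/
theorem harmonicKyFan_chain_lower :
    ∀ x y : ℝ, 0 < x → x ≤ 1 / 2 → 0 < y → y ≤ 1 / 2 →
      (1 / seiffertMean id x y - 1 / seiffertMean id (1 - x) (1 - y) ≤
        1 / seiffertMean Real.sinh x y - 1 / seiffertMean Real.sinh (1 - x) (1 - y)) ∧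
      (1 / seiffertMean Real.sinh x y - 1 / seiffertMean Real.sinh (1 - x) (1 - y) ≤
          1 / seiffertMean Real.tan x y - 1 / seiffertMean Real.tan (1 - x) (1 - y) ∧
        1 / seiffertMean Real.tan x y - 1 / seiffertMean Real.tan (1 - x) (1 - y) ≤
          1 / seiffertMean artanh x y - 1 / seiffertMean artanh (1 - x) (1 - y)) ∧
      (1 / seiffertMean Real.sinh x y - 1 / seiffertMean Real.sinh (1 - x) (1 - y) ≤
          1 / seiffertMean Real.arcsin x y - 1 / seiffertMean Real.arcsin (1 - x) (1 - y) ∧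
        1 / seiffertMean Real.arcsin x y - 1 / seiffertMean Real.arcsin (1 - x) (1 - y) ≤
          1 / seiffertMean artanh x y - 1 / seiffertMean artanh (1 - x) (1 - y)) := by
  intro x y hx0 hx hy0 hy
  have hid : ∀ z ∈ Set.Ioo (0 : ℝ) 1, HasDerivAt id 1 z := fun z _ => hasDerivAt_id z
  have hsinh : ∀ z ∈ Set.Ioo (0 : ℝ) 1, HasDerivAt Real.sinh (Real.cosh z) z :=
    fun z _ => Real.hasDerivAt_sinh z
  have htan : ∀ z ∈ Set.Ioo (0 : ℝ) 1, HasDerivAt Real.tan (1 / Real.cos z ^ 2) z :=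
    fun z hz => Real.hasDerivAt_tan (cos_pos_of_mem_Ioo_zero_one hz).ne'
  have harcsin : ∀ z ∈ Set.Ioo (0 : ℝ) 1, HasDerivAt Real.arcsin (1 / √(1 - z ^ 2)) z :=
    fun z hz => Real.hasDerivAt_arcsin (by linarith [hz.1]) hz.2.ne
  have hartanh : ∀ z ∈ Set.Ioo (0 : ℝ) 1, HasDerivAt artanh (1 / (1 - z ^ 2)) z :=
    fun z hz => hasDerivAt_artanh hz
  exact
    ⟨one_div_seiffertMean_sub_le hid hsinh (fun z _ => Real.one_le_cosh z) hx0 hx hy0 hy,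
      ⟨one_div_seiffertMean_sub_le hsinh htan
          (fun z hz => (cosh_le_one_add_sq hz).trans (one_add_sq_le_one_div_cos_sq hz))
          hx0 hx hy0 hy,
        one_div_seiffertMean_sub_le htan hartanh (fun z hz => one_div_cos_sq_le hz)
          hx0 hx hy0 hy⟩,
      ⟨one_div_seiffertMean_sub_le hsinh harcsin (fun z hz => cosh_le_one_div_sqrt hz)
          hx0 hx hy0 hy,
        one_div_seiffertMean_sub_le harcsin hartanh (fun z hz => one_div_sqrt_le hz)
          hx0 hx hy0 hy⟩⟩
end

section
/- For all t with 0 < t < 1, t^{4/3} + t - t^{1/3} - 1 - (t + t^{1/3})·log t < 0. -/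
/-- A rational lower bound for the logarithm on `(0, 1)`. -/
lemma div_lt_three_mul_log {s : ℝ} (hs : 0 < s) (hs1 : s < 1) :
    (s ^ 4 + s ^ 3 - s - 1) / (s ^ 3 + s) < 3 * Real.log s := by
  have hderiv (x : ℝ) (hx : 0 < x) :
      HasDerivAt (fun y : ℝ ↦ 3 * Real.log y - (y ^ 4 + y ^ 3 - y - 1) / (y ^ 3 + y))
        (-((x - 1) ^ 4 * (x ^ 2 + x + 1) / (x ^ 3 + x) ^ 2)) x := by
    have hD : x ^ 3 + x ≠ 0 := by positivity
    have hnum : HasDerivAt (fun y : ℝ ↦ y ^ 4 + y ^ 3 - y - 1) (4 * x ^ 3 + 3 * x ^ 2 - 1) x := by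
      simpa using (((hasDerivAt_pow 4 x).add (hasDerivAt_pow 3 x)).sub (hasDerivAt_id x)).sub_const 1
    have hden : HasDerivAt (fun y : ℝ ↦ y ^ 3 + y) (3 * x ^ 2 + 1) x := by
      simpa using (hasDerivAt_pow 3 x).fun_add (hasDerivAt_id' x)
    refine (((Real.hasDerivAt_log hx.ne').const_mul 3).sub (hnum.div hden hD)).congr_deriv ?_
    have hD' : x ^ 2 + 1 ≠ 0 := by positivity
    rw [show x ^ 3 + x = x * (x ^ 2 + 1) by ring]
    field_simp
    ring
  have hanti : StrictAntiOn
      (fun y : ℝ ↦ 3 * Real.log y - (y ^ 4 + y ^ 3 - y - 1) / (y ^ 3 + y)) (Set.Ioc 0 1) := by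
    refine strictAntiOn_of_deriv_neg (convex_Ioc 0 1)
      (fun x hx ↦ (hderiv x hx.1).continuousAt.continuousWithinAt) fun x hx ↦ ?_
    rw [interior_Ioc] at hx
    obtain ⟨hx0, hx1⟩ := hx
    have : 0 < (1 - x) ^ 4 := pow_pos (sub_pos.2 hx1) 4
    rw [(hderiv x hx0).deriv, neg_lt_zero, show (x - 1) ^ 4 = (1 - x) ^ 4 by ring]
    positivity
  have h := hanti ⟨hs, hs1.le⟩ ⟨one_pos, le_rfl⟩ hs1
  norm_num at h
  linarith

/-- for `0 < t < 1`,
`t^{4/3} + t - t^{1/3} - 1 - (t + t^{1/3}) log t < 0`. -/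
theorem rpow_log_ineq :
    ∀ t ∈ Set.Ioo (0 : ℝ) 1,
      t ^ ((4 : ℝ) / 3) + t - t ^ ((1 : ℝ) / 3) - 1 -
        (t + t ^ ((1 : ℝ) / 3)) * Real.log t < 0 := by
  rintro t ⟨ht0, ht1⟩
  obtain ⟨s, hs⟩ : ∃ s, s = t ^ ((1 : ℝ) / 3) := ⟨_, rfl⟩
  have hs0 : 0 < s := hs ▸ Real.rpow_pos_of_pos ht0 _
  have hs1 : s < 1 := hs ▸ Real.rpow_lt_one ht0.le ht1 (by norm_num)
  have h3 : t = s ^ 3 := by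
    rw [hs, ← Real.rpow_natCast, ← Real.rpow_mul ht0.le]
    norm_num
  have h4 : t ^ ((4 : ℝ) / 3) = s ^ 4 := by
    rw [hs, ← Real.rpow_natCast, ← Real.rpow_mul ht0.le]
    norm_num
  have hlog : Real.log t = 3 * Real.log s := by
    rw [h3, Real.log_pow]
    norm_num
  have h := div_lt_three_mul_log hs0 hs1
  rw [div_lt_iff₀ (by positivity)] at h
  rw [h4, ← hs, hlog, h3]
  linarith
end

section
/- For all z with 0 < z < 1, cos(z)·cosh(z) < 1; consequently the function z ↦ tan(z) - sinh(z) is strictly increasing on (0,1). -/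
theorem cos_mul_sinh_lt_sin_mul_cosh {z : ℝ} (h0 : 0 < z) (hpi : z ≤ Real.pi) :
    Real.cos z * Real.sinh z < Real.sin z * Real.cosh z := by
  have hd (x : ℝ) : HasDerivAt (fun x => Real.cos x * Real.sinh x - Real.sin x * Real.cosh x)
      (-2 * (Real.sin x * Real.sinh x)) x :=
    (((Real.hasDerivAt_cos x).mul (Real.hasDerivAt_sinh x)).sub
      ((Real.hasDerivAt_sin x).mul (Real.hasDerivAt_cosh x))).congr_deriv (by ring)
  have hanti : StrictAntiOn (fun x => Real.cos x * Real.sinh x - Real.sin x * Real.cosh x)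
      (Set.Icc 0 Real.pi) := by
    refine strictAntiOn_of_deriv_neg (convex_Icc _ _)
      (fun x _ => (hd x).continuousAt.continuousWithinAt) fun x hx => ?_
    rw [interior_Icc] at hx
    rw [(hd x).deriv]
    have := mul_pos (Real.sin_pos_of_mem_Ioo hx) (Real.sinh_pos_iff.2 hx.1)
    linarith
  simpa using hanti (Set.left_mem_Icc.2 Real.pi_pos.le) ⟨h0.le, hpi⟩ h0

theorem cos_mul_cosh_lt_one {z : ℝ} (h0 : 0 < z) (hpi : z ≤ Real.pi) :
    Real.cos z * Real.cosh z < 1 := by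
  have hd (x : ℝ) : HasDerivAt (fun x => Real.cos x * Real.cosh x)
      (Real.cos x * Real.sinh x - Real.sin x * Real.cosh x) x :=
    ((Real.hasDerivAt_cos x).mul (Real.hasDerivAt_cosh x)).congr_deriv (by ring)
  have hanti : StrictAntiOn (fun x => Real.cos x * Real.cosh x) (Set.Icc 0 Real.pi) := by
    refine strictAntiOn_of_deriv_neg (convex_Icc _ _)
      (fun x _ => (hd x).continuousAt.continuousWithinAt) fun x hx => ?_
    rw [interior_Icc] at hx
    rw [(hd x).deriv]
    exact sub_neg.2 (cos_mul_sinh_lt_sin_mul_cosh hx.1 hx.2.le)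
  simpa using hanti (Set.left_mem_Icc.2 Real.pi_pos.le) ⟨h0.le, hpi⟩ h0

theorem strictMonoOn_tan_sub_sinh :
    StrictMonoOn (fun z => Real.tan z - Real.sinh z) (Set.Ioo 0 (Real.pi / 2)) := by
  have hcos {x : ℝ} (hx : x ∈ Set.Ioo 0 (Real.pi / 2)) : 0 < Real.cos x :=
    Real.cos_pos_of_mem_Ioo ⟨by linarith [hx.1, Real.pi_pos], hx.2⟩
  have hd {x : ℝ} (hx : x ∈ Set.Ioo 0 (Real.pi / 2)) :
      HasDerivAt (fun z => Real.tan z - Real.sinh z) (1 / Real.cos x ^ 2 - Real.cosh x) x :=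
    (Real.hasDerivAt_tan (hcos hx).ne').sub (Real.hasDerivAt_sinh x)
  refine strictMonoOn_of_deriv_pos (convex_Ioo _ _)
    (fun x hx => (hd hx).continuousAt.continuousWithinAt) fun x hx => ?_
  rw [interior_Ioo] at hx
  rw [(hd hx).deriv, sub_pos, lt_div_iff₀ (pow_pos (hcos hx) 2)]
  have hlt := cos_mul_cosh_lt_one hx.1 (by linarith [hx.2, Real.pi_pos])
  calc Real.cosh x * Real.cos x ^ 2 = Real.cos x * (Real.cos x * Real.cosh x) := by ring
    _ < Real.cos x * 1 := mul_lt_mul_of_pos_left hlt (hcos hx)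
    _ ≤ 1 := by simpa using Real.cos_le_one x

/-- for `0 < z < 1`, `cos z * cosh z < 1`; consequently
`z ↦ tan z - sinh z` is strictly increasing on `(0,1)`. -/
theorem cos_mul_cosh_lt_one_and_tan_sub_sinh_strictMono :
    (∀ z ∈ Set.Ioo (0 : ℝ) 1, Real.cos z * Real.cosh z < 1) ∧
    StrictMonoOn (fun z => Real.tan z - Real.sinh z) (Set.Ioo (0 : ℝ) 1) :=
  ⟨fun _ hz => cos_mul_cosh_lt_one hz.1 (by linarith [hz.2, Real.pi_gt_three]),
    strictMonoOn_tan_sub_sinh.mono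
      (Set.Ioo_subset_Ioo_right (by linarith [Real.pi_gt_three]))⟩
end

section
/- For all z with 0 < z < 1, cosh(z) < 1 + z²/2 + z⁴/12; consequently the function z ↦ arcsin(z) - sinh(z) is strictly increasing on (0,1). -/
theorem Real.cosh_lt_one_add_sq_add_pow_four {z : ℝ} (h0 : 0 < z) (h1 : z ≤ 1) :
    Real.cosh z < 1 + z ^ 2 / 2 + z ^ 4 / 12 := by
  have hz : |z| = z := abs_of_pos h0
  have hp := abs_le.1 (Real.exp_bound (x := z) (by rwa [hz]) (n := 4) (by norm_num))
  have hn := abs_le.1 (Real.exp_bound (x := -z) (by rwa [abs_neg, hz]) (n := 4) (by norm_num))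
  rw [abs_neg] at hn
  rw [hz] at hp hn
  norm_num [Finset.sum_range_succ, Nat.factorial] at hp hn
  rw [Real.cosh_eq]
  have h4 : 0 < z ^ 4 := by positivity
  have h3 : (-z) ^ 3 = -z ^ 3 := by ring
  rw [h3] at hn
  linarith [hp.2, hn.2]

theorem Real.cosh_lt_one_div_sqrt_one_sub_sq {z : ℝ} (h0 : 0 < z) (h1 : z < 1) :
    Real.cosh z < 1 / √(1 - z ^ 2) := by
  have hz : 0 < 1 - z ^ 2 := by nlinarith
  have hc := Real.cosh_lt_one_add_sq_add_pow_four h0 h1.le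
  refine hc.trans ?_
  rw [lt_div_iff₀ (Real.sqrt_pos.2 hz)]
  refine lt_of_pow_lt_pow_left₀ 2 zero_le_one ?_
  rw [mul_pow, Real.sq_sqrt hz.le]
  have h4 : 0 < z ^ 4 := by positivity
  have h6 : 0 < z ^ 6 := by positivity
  have h8 : 0 < z ^ 8 := by positivity
  have h10 : 0 < z ^ 10 := by positivity
  linarith

/-- for `0 < z < 1`, `cosh z < 1 + z²/2 + z⁴/12`; consequently
`z ↦ arcsin z - sinh z` is strictly increasing on `(0,1)`. -/
theorem cosh_lt_and_arcsin_sub_sinh_strictMono :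
    (∀ z ∈ Set.Ioo (0 : ℝ) 1, Real.cosh z < 1 + z ^ 2 / 2 + z ^ 4 / 12) ∧
    StrictMonoOn (fun z => Real.arcsin z - Real.sinh z) (Set.Ioo (0 : ℝ) 1) := by
  refine ⟨fun z hz => Real.cosh_lt_one_add_sq_add_pow_four hz.1 hz.2.le, ?_⟩
  refine strictMonoOn_of_deriv_pos (convex_Ioo 0 1)
    (Real.continuous_arcsin.sub Real.continuous_sinh).continuousOn fun z hz => ?_
  rw [interior_Ioo] at hz
  have hd := (Real.hasDerivAt_arcsin (by linarith [hz.1]) hz.2.ne).sub (Real.hasDerivAt_sinh z)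
  exact (sub_pos.2 (Real.cosh_lt_one_div_sqrt_one_sub_sq hz.1 hz.2)).trans_eq hd.deriv.symm
end
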